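/- arXiv:1808.09584 — 6 statements merged into one kernel-verified Lean document; each statement's English description precedes it below -/
import Mathlib

section
/- A continuum X is homeomorphic to the unit circle S¹ = {(x,y) ∈ ℝ² : x² + y² = 1} if and only if NB(F₁(X)) = F₁(X), that is, the nonempty proper closed subsets of X that do not block any point of their complement are exactly the one-point subsets of X. -/
open Set Filter Metric

/-- `B` does not block `x`: the union of all subcontinua of `X` containing `x`
and contained in the complement of `B` is dense. -/
def NotBlocks {X : Type*} [TopologicalSpace X] (B : Set X) (x : X) : Prop :=
  Dense (⋃₀ {K : Set X | IsCompact K ∧ IsConnected K ∧ x ∈ K ∧ K ⊆ Bᶜ})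

/-- The hyperspace `NB(F₁(X))`: nonempty proper closed subsets that do not block
any point of their complement. -/
def NB (X : Type*) [TopologicalSpace X] : Set (Set X) :=
  {B | B.Nonempty ∧ B ≠ univ ∧ IsClosed B ∧ ∀ x ∉ B, NotBlocks B x}

/-- The hyperspace `NB*(F₁(X))`: nonempty proper closed subsets that do not block
at least one point of their complement. -/
def NBstar (X : Type*) [TopologicalSpace X] : Set (Set X) :=
  {B | B.Nonempty ∧ B ≠ univ ∧ IsClosed B ∧ ∃ x ∉ B, NotBlocks B x}

/-- `F₁(X)`: the one-point subsets of `X`. -/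
def F1 (X : Type*) [TopologicalSpace X] : Set (Set X) :=
  {A | ∃ x : X, A = {x}}

/-- `NWC(X)`: nonempty proper closed subsets with empty interior that are
non-weak cut sets. -/
def NWC (X : Type*) [TopologicalSpace X] : Set (Set X) :=
  {A | A.Nonempty ∧ A ≠ univ ∧ IsClosed A ∧ interior A = ∅ ∧
    ∀ x ∉ A, ∀ y ∉ A, ∃ K : Set X, IsCompact K ∧ IsConnected K ∧ K ⊆ Aᶜ ∧ x ∈ K ∧ y ∈ K}

/-- A shore set: a nonempty proper closed subset `A` such that some sequence of
subcontinua contained in the complement of `A` converges to `X` in the Hausdorff metric. -/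
def ShoreSet {X : Type*} [MetricSpace X] (A : Set X) : Prop :=
  A.Nonempty ∧ A ≠ univ ∧ IsClosed A ∧
    ∃ C : ℕ → Set X, (∀ n, IsCompact (C n) ∧ IsConnected (C n) ∧ C n ⊆ Aᶜ) ∧
      Tendsto (fun n => hausdorffDist (C n) (univ : Set X)) atTop (nhds 0)

/-- `S(X)`: the collection of all shore sets of `X`. -/
def Shore (X : Type*) [MetricSpace X] : Set (Set X) :=
  {A | ShoreSet A}

/-- The composant of a point `z`: the union of all proper subcontinua containing `z`. -/
def composant {X : Type*} [TopologicalSpace X] (z : X) : Set X :=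
  ⋃₀ {L : Set X | IsCompact L ∧ IsConnected L ∧ L ≠ univ ∧ z ∈ L}

/-- `X` is irreducible between `p` and `q`: no proper subcontinuum contains both. -/
def IrrBetween {X : Type*} [TopologicalSpace X] (p q : X) : Prop :=
  ∀ L : Set X, IsCompact L → IsConnected L → p ∈ L → q ∈ L → L = univ

/-- A subcontinuum `K` is decomposable if it is the union of two proper subcontinua. -/
def DecomposableSet {X : Type*} [TopologicalSpace X] (K : Set X) : Prop :=
  ∃ A B : Set X, IsCompact A ∧ IsConnected A ∧ A ⊆ K ∧ A ≠ K ∧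
    IsCompact B ∧ IsConnected B ∧ B ⊆ K ∧ B ≠ K ∧ A ∪ B = K

/-- `s(x)` relative to the point `p`: the union of all subcontinua containing `x`
and contained in `X \ {p}`. -/
def sComp {X : Type*} [TopologicalSpace X] (p x : X) : Set X :=
  ⋃₀ {K : Set X | IsCompact K ∧ IsConnected K ∧ x ∈ K ∧ K ⊆ ({p} : Set X)ᶜ}

section Continua

variable {X : Type*} [TopologicalSpace X]

/-- Closed connected sets; in a compact space these are exactly the subcontinua. -/
def IsContinuum (K : Set X) : Prop := IsClosed K ∧ IsConnected K

/-- `x` and `y` lie in a common subcontinuum that misses `F`. -/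
def JoinedOff (F : Set X) (x y : X) : Prop :=
  ∃ K : Set X, IsContinuum K ∧ x ∈ K ∧ y ∈ K ∧ Disjoint K F

theorem IsContinuum.union {A B : Set X} (hA : IsContinuum A) (hB : IsContinuum B)
    (h : (A ∩ B).Nonempty) : IsContinuum (A ∪ B) :=
  ⟨hA.1.union hB.1, hA.2.union h hB.2⟩

theorem JoinedOff.symm {F : Set X} {x y : X} (h : JoinedOff F x y) : JoinedOff F y x := by
  obtain ⟨K, hK, hx, hy, hd⟩ := h
  exact ⟨K, hK, hy, hx, hd⟩

theorem JoinedOff.trans {F : Set X} {x y z : X} (h : JoinedOff F x y) (h' : JoinedOff F y z) :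
    JoinedOff F x z := by
  obtain ⟨K, hK, hx, hy, hd⟩ := h
  obtain ⟨K', hK', hx', hy', hd'⟩ := h'
  exact ⟨K ∪ K', hK.union hK' ⟨y, hy, hx'⟩, Or.inl hx, Or.inr hy', hd.union_left hd'⟩

theorem JoinedOff.mono {F G : Set X} {x y : X} (h : JoinedOff F x y) (hG : G ⊆ F) :
    JoinedOff G x y := by
  obtain ⟨K, hK, hx, hy, hd⟩ := h
  exact ⟨K, hK, hx, hy, hd.mono_right hG⟩

theorem JoinedOff.notMem_left {F : Set X} {x y : X} (h : JoinedOff F x y) : x ∉ F := by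
  obtain ⟨K, _, hx, _, hd⟩ := h
  exact fun hF => disjoint_left.1 hd hx hF

theorem notBlocks_iff_dense_joinedOff [CompactSpace X] [T2Space X] {B : Set X} {x : X} :
    NotBlocks B x ↔ Dense {y | JoinedOff B x y} := by
  unfold NotBlocks
  have : (⋃₀ {K : Set X | IsCompact K ∧ IsConnected K ∧ x ∈ K ∧ K ⊆ Bᶜ}) =
      {y | JoinedOff B x y} := by
    ext y
    constructor
    · rintro ⟨K, ⟨hc, hK, hx, hB⟩, hy⟩
      exact ⟨K, ⟨hc.isClosed, hK⟩, hx, hy, disjoint_left.2 fun a ha => hB ha⟩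
    · rintro ⟨K, ⟨hc, hK⟩, hx, hy, hB⟩
      exact ⟨K, ⟨hc.isCompact, hK, hx, fun a ha => disjoint_left.1 hB ha⟩, hy⟩
  rw [this]

theorem IsClosed.isClosed_connectedComponentIn {F : Set X} (hF : IsClosed F) (x : X) :
    IsClosed (connectedComponentIn F x) := by
  by_cases hx : x ∈ F
  · refine isClosed_of_closure_subset ?_
    have h1 : IsPreconnected (closure (connectedComponentIn F x)) :=
      isPreconnected_connectedComponentIn.closure
    exact h1.subset_connectedComponentIn (subset_closure (mem_connectedComponentIn hx))
      (closure_minimal (connectedComponentIn_subset F x) hF)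
  · rw [connectedComponentIn_eq_empty hx]
    exact isClosed_empty

theorem IsClosed.isContinuum_connectedComponentIn {F : Set X} (hF : IsClosed F) {x : X}
    (hx : x ∈ F) : IsContinuum (connectedComponentIn F x) :=
  ⟨hF.isClosed_connectedComponentIn x, isConnected_connectedComponentIn_iff.2 hx⟩

theorem IsContinuum.closure_of_isConnected {A : Set X} (h : IsConnected A) :
    IsContinuum (closure A) := ⟨isClosed_closure, h.closure⟩

/-- Boundary bumping. -/
theorem IsContinuum.exists_inter_of_subset_union [CompactSpace X] [T2Space X] {K A F : Set X}
    (hK : IsContinuum K) (hA : IsClosed A) (hF : IsClosed F) (hKAF : K ⊆ A ∪ F) {w : X}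
    (hwK : w ∈ K) (hwA : w ∈ A) (hKF : (K ∩ F).Nonempty) :
    ∃ C, IsContinuum C ∧ w ∈ C ∧ C ⊆ K ∩ A ∧ (C ∩ F).Nonempty := by
  have hcl : IsClosed (K ∩ A) := hK.1.inter hA
  have hw : w ∈ K ∩ A := ⟨hwK, hwA⟩
  refine ⟨connectedComponentIn (K ∩ A) w, hcl.isContinuum_connectedComponentIn hw,
    mem_connectedComponentIn hw, connectedComponentIn_subset _ _, ?_⟩
  by_contra hne
  rw [not_nonempty_iff_eq_empty] at hne
  have : CompactSpace (K ∩ A : Set X) := isCompact_iff_compactSpace.1 hcl.isCompact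
  set w' : (K ∩ A : Set X) := ⟨w, hw⟩
  have hcc : connectedComponent w' ⊆ ((↑) ⁻¹' F : Set (K ∩ A : Set X))ᶜ := by
    intro z hz hzF
    have : (z : X) ∈ connectedComponentIn (K ∩ A) w := by
      rw [connectedComponentIn_eq_image hw]
      exact ⟨z, hz, rfl⟩
    have h2 : (z : X) ∈ connectedComponentIn (K ∩ A) w ∩ F := ⟨this, hzF⟩
    rw [hne] at h2
    exact h2
  rw [connectedComponent_eq_iInter_isClopen] at hcc
  have hopen : IsOpen ((↑) ⁻¹' F : Set (K ∩ A : Set X))ᶜ :=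
    (hF.preimage continuous_subtype_val).isOpen_compl
  have : Nonempty {s : Set (K ∩ A : Set X) // IsClopen s ∧ w' ∈ s} :=
    ⟨⟨univ, isClopen_univ, mem_univ _⟩⟩
  obtain ⟨⟨D, hD, hwD⟩, hDF⟩ := exists_subset_nhds_of_isCompact'
    (V := fun s : {s : Set (K ∩ A : Set X) // IsClopen s ∧ w' ∈ s} => (s : Set _))
    (by
      intro s t
      exact ⟨⟨s.1 ∩ t.1, s.2.1.inter t.2.1, s.2.2, t.2.2⟩, inter_subset_left, inter_subset_right⟩)
    (fun s => s.2.1.isClosed.isCompact) (fun s => s.2.1.isClosed)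
    (U := ((↑) ⁻¹' F : Set (K ∩ A : Set X))ᶜ) (fun x hx => hopen.mem_nhds (hcc hx))
  have hemb : Topology.IsClosedEmbedding ((↑) : (K ∩ A : Set X) → X) :=
    hcl.isClosedEmbedding_subtypeVal
  have h1 : IsClosed ((↑) '' D : Set X) := hemb.isClosedMap _ hD.isClosed
  have h2 : IsClosed ((↑) '' Dᶜ : Set X) := hemb.isClosedMap _ hD.compl.isClosed
  obtain ⟨z, hzK, hzF⟩ := hKF
  have := isPreconnected_closed_iff.1 hK.2.isPreconnected ((↑) '' D) ((↑) '' Dᶜ ∪ K ∩ F) h1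
    (h2.union (hK.1.inter hF)) (by
      intro y hy
      by_cases hyA : y ∈ A
      · by_cases hyD : (⟨y, hy, hyA⟩ : (K ∩ A : Set X)) ∈ D
        · exact Or.inl ⟨_, hyD, rfl⟩
        · exact Or.inr (Or.inl ⟨_, hyD, rfl⟩)
      · exact Or.inr (Or.inr ⟨hy, (hKAF hy).resolve_left hyA⟩))
    ⟨w, hwK, ⟨w', hwD, rfl⟩⟩ ⟨z, hzK, Or.inr ⟨hzK, hzF⟩⟩
  obtain ⟨y, hyK, ⟨d, hd, rfl⟩, hy2⟩ := this
  rcases hy2 with ⟨e, he, hed⟩ | hy2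
  · exact he (Subtype.ext hed ▸ hd)
  · exact hDF hd hy2.2

theorem IsPreconnected.union_of_diff_eq {Y A U V : Set X} (hY : IsPreconnected Y)
    (hAY : A ⊆ Y) (hA : IsPreconnected A) (hAne : A.Nonempty) (hU : IsOpen U) (hV : IsOpen V)
    (hUV : Disjoint U V) (h : Y \ A = U ∪ V) : IsPreconnected (A ∪ U) := by
  have hUY : U ⊆ Y := fun x hx => (h.symm ▸ (Or.inl hx : x ∈ U ∪ V) : x ∈ Y \ A).1
  have hVA : Disjoint V A := disjoint_left.2 fun x hx =>
    (h.symm ▸ (Or.inr hx : x ∈ U ∪ V) : x ∈ Y \ A).2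
  have key : ∀ u v : Set X, IsOpen u → IsOpen v → A ∪ U ⊆ u ∪ v →
      (A ∪ U) ∩ (u ∩ v) = ∅ → A ⊆ u → A ∪ U ⊆ u := by
    intro u v hu hv hc hd hAu
    have := hY.subset_left_of_subset_union (u := u ∪ V) (v := U ∩ v) (hu.union hV)
      (hU.inter hv) ?_ ?_ ?_
    · rintro x (hx | hx)
      · exact hAu hx
      · rcases this (hUY hx) with h' | h'
        · exact h'
        · exact absurd h' (disjoint_left.1 hUV hx)
    · refine disjoint_left.2 ?_
      rintro x (hx | hx) ⟨hxU, hxv⟩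
      · exact (hd ▸ ⟨Or.inr hxU, hx, hxv⟩ : x ∈ (∅ : Set X))
      · exact disjoint_left.1 hUV hxU hx
    · intro x hx
      by_cases hxA : x ∈ A
      · exact Or.inl (Or.inl (hAu hxA))
      · rcases (h ▸ (⟨hx, hxA⟩ : x ∈ Y \ A) : x ∈ U ∪ V) with hxU | hxV
        · rcases hc (Or.inr hxU) with h' | h'
          · exact Or.inl (Or.inl h')
          · exact Or.inr ⟨hxU, h'⟩
        · exact Or.inl (Or.inr hxV)
    · obtain ⟨a, ha⟩ := hAne
      exact ⟨a, hAY ha, Or.inl (hAu ha)⟩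
  rw [isPreconnected_iff_subset_of_disjoint]
  intro u v hu hv hc hd
  have hd' : (A ∪ U) ∩ (v ∩ u) = ∅ := by rw [inter_comm v u]; exact hd
  rcases isPreconnected_iff_subset_of_disjoint.1 hA u v hu hv (subset_union_left.trans hc)
    (subset_eq_empty (inter_subset_inter_left _ subset_union_left) hd) with h1 | h1
  · exact Or.inl (key u v hu hv hc hd h1)
  · exact Or.inr (key v u hv hu (union_comm u v ▸ hc) hd' h1)

theorem IsOpen.exists_subset_closure_of_subset_iUnion [BaireSpace X] {ι : Type*} [Countable ι]
    {O : Set X} (hO : IsOpen O) (hne : O.Nonempty) {F : ι → Set X} (hF : O ⊆ ⋃ i, F i) :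
    ∃ i, ∃ O' ⊆ O, IsOpen O' ∧ O'.Nonempty ∧ O' ⊆ closure (F i) := by
  by_contra! hcon
  refine not_isMeagre_of_isOpen hO hne ?_
  have : IsMeagre (⋃ i, F i ∩ O) := by
    refine isMeagre_iUnion fun i => IsNowhereDense.isMeagre ?_
    rw [IsNowhereDense, eq_empty_iff_forall_notMem]
    intro x hx
    have h1 : x ∈ closure (F i ∩ O) := interior_subset hx
    obtain ⟨y, hy, hyF, hyO⟩ := mem_closure_iff.1 h1 _ isOpen_interior hx
    refine hcon i (interior (closure (F i ∩ O)) ∩ O) inter_subset_right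
      (isOpen_interior.inter hO) ⟨y, hy, hyO⟩ ?_
    exact inter_subset_left.trans (interior_subset.trans (closure_mono inter_subset_left))
  exact this.mono fun x hx => by
    obtain ⟨i, hi⟩ := mem_iUnion.1 (hF hx)
    exact mem_iUnion.2 ⟨i, hi, hx⟩

end Continua

section Continua

variable {X : Type*} [TopologicalSpace X]

theorem IsOpen.exists_separation {O : Set X} (hO : IsOpen O) (h : ¬ IsPreconnected O) :
    ∃ U V : Set X, IsOpen U ∧ IsOpen V ∧ U.Nonempty ∧ V.Nonempty ∧ Disjoint U V ∧ U ∪ V = O := by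
  rw [isPreconnected_iff_subset_of_disjoint] at h
  push Not at h
  obtain ⟨u, v, hu, hv, hc, hd, h1, h2⟩ := h
  obtain ⟨x, hx, hxu⟩ := not_subset.1 h1
  obtain ⟨y, hy, hyv⟩ := not_subset.1 h2
  refine ⟨O ∩ u, O ∩ v, hO.inter hu, hO.inter hv, ⟨y, hy, (hc hy).resolve_right hyv⟩,
    ⟨x, hx, (hc hx).resolve_left hxu⟩, disjoint_left.2 ?_, ?_⟩
  · rintro z ⟨hz, hzu⟩ ⟨-, hzv⟩
    exact (hd ▸ ⟨hz, hzu, hzv⟩ : z ∈ (∅ : Set X))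
  · rw [← inter_union_distrib_left]
    exact inter_eq_left.2 hc

theorem IsPreconnected.subset_or_subset_of_disjoint {S U V : Set X} (hS : IsPreconnected S)
    (hU : IsOpen U) (hV : IsOpen V) (hUV : Disjoint U V) (h : S ⊆ U ∪ V) : S ⊆ U ∨ S ⊆ V :=
  isPreconnected_iff_subset_of_disjoint.1 hS U V hU hV h (by rw [hUV.inter_eq, inter_empty])

theorem not_isPreconnected_of_disjoint {S U V : Set X}
    (hU : IsOpen U) (hV : IsOpen V) (hUV : Disjoint U V) (h : S ⊆ U ∪ V)
    (hSU : (S ∩ U).Nonempty) (hSV : (S ∩ V).Nonempty) : ¬ IsPreconnected S := by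
  intro hS
  rcases hS.subset_or_subset_of_disjoint hU hV hUV h with h | h
  · obtain ⟨x, hx, hxV⟩ := hSV
    exact disjoint_left.1 hUV (h hx) hxV
  · obtain ⟨x, hx, hxU⟩ := hSU
    exact disjoint_left.1 hUV hxU (h hx)

theorem isContinuum_singleton [T1Space X] (p : X) : IsContinuum {p} :=
  ⟨isClosed_singleton, isConnected_singleton⟩

/-- No one-point set blocks any other point. -/
def PointsNonblocking (X : Type*) [TopologicalSpace X] : Prop :=
  ∀ p x : X, x ≠ p → Dense {y | JoinedOff {p} x y}

/-- Every two-point set blocks some other point. -/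
def PairsBlocking (X : Type*) [TopologicalSpace X] : Prop :=
  ∀ p q : X, p ≠ q → ∃ x, x ∉ ({p, q} : Set X) ∧ ¬ Dense {y | JoinedOff {p, q} x y}

theorem PairsBlocking.not_forall_joinedOff [T1Space X] [ConnectedSpace X] (H : PairsBlocking X)
    {p q z : X} (hpq : p ≠ q) (hz : ∀ w, w ≠ p → w ≠ q → JoinedOff {p, q} w z) : False := by
  obtain ⟨x, hx, hd⟩ := H p q hpq
  have : Nontrivial X := ⟨p, q, hpq⟩
  have h1 : Dense (({p, q} : Set X)ᶜ) := by
    rw [compl_eq_univ_sdiff]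
    exact dense_univ.sdiff_finite (toFinite _)
  refine hd (h1.mono fun y hy => ?_)
  have ne : ∀ w, w ∉ ({p, q} : Set X) → JoinedOff {p, q} w z := fun w hw =>
    hz w (fun h => hw (by simp [h])) (fun h => hw (by simp [h]))
  exact (ne x hx).trans (ne y hy).symm

theorem PointsNonblocking.joinedOff_of_interior (H : PointsNonblocking X) {B : Set X}
    (hB : IsContinuum B) (hBi : (interior B).Nonempty) {p b w : X} (hp : p ∉ B) (hb : b ∈ B)
    (hw : w ≠ p) : JoinedOff {p} w b := by
  obtain ⟨y, hy, hyB⟩ := (H p w hw).exists_mem_open isOpen_interior hBi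
  exact hy.trans ⟨B, hB, interior_subset hyB, hb, disjoint_singleton_right.2 hp⟩

end Continua

section CompactConnected

variable {X : Type*} [TopologicalSpace X] [T2Space X] [CompactSpace X] [ConnectedSpace X]

theorem IsContinuum.not_isConnected_inter (H1 : PointsNonblocking X) (H2 : PairsBlocking X)
    {A B : Set X} (hA : IsContinuum A) (hB : IsContinuum B) (hAB : A ∪ B = univ)
    (hA' : A ≠ univ) (hB' : B ≠ univ) : ¬ IsConnected (A ∩ B) := by
  intro hc
  obtain ⟨q, hqB⟩ := (ne_univ_iff_exists_notMem _).1 hB'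
  obtain ⟨r, hrA⟩ := (ne_univ_iff_exists_notMem _).1 hA'
  have hun : ∀ x, x ∈ A ∨ x ∈ B := fun x => (hAB ▸ mem_univ x : x ∈ A ∪ B)
  have hqA := (hun q).resolve_right hqB
  have hrB := (hun r).resolve_left hrA
  obtain ⟨z, hz⟩ := hc.nonempty
  have key : ∀ {A B : Set X} {q r : X}, IsContinuum A → IsContinuum B → (∀ x, x ∈ A ∨ x ∈ B) →
      q ∉ B → r ∉ A → z ∈ A ∩ B → IsConnected (A ∩ B) → ∀ w ∈ A, w ≠ q → JoinedOff {q, r} w z := by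
    intro A B q r hA hB hun hq hr hz hc w hwA hwq
    have hi : (interior B).Nonempty := ⟨r, mem_interior.2 ⟨Aᶜ, fun x hx =>
      (hun x).resolve_left hx, hA.1.isOpen_compl, hr⟩⟩
    obtain ⟨K, hK, hwK, hzK, hKq⟩ := H1.joinedOff_of_interior hB hi hq hz.2 hwq
    obtain ⟨C, hC, hwC, hCs, x, hxC, hxB⟩ := hK.exists_inter_of_subset_union hA.1 hB.1
      (fun x _ => hun x) hwK hwA ⟨z, hzK, hz.2⟩
    have h1 : JoinedOff {q, r} w x := by
      refine ⟨C, hC, hwC, hxC, disjoint_left.2 ?_⟩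
      rintro y hy (rfl | rfl)
      · exact disjoint_left.1 hKq (hCs hy).1 rfl
      · exact hr (hCs hy).2
    refine h1.trans ⟨A ∩ B, ⟨hA.1.inter hB.1, hc⟩, ⟨(hCs hxC).2, hxB⟩, hz, disjoint_left.2 ?_⟩
    rintro y hy (rfl | rfl)
    · exact hq hy.2
    · exact hr hy.1
  refine H2.not_forall_joinedOff (p := q) (q := r) (z := z) (fun h => hrA (h ▸ hqA)) ?_
  intro w hwq hwr
  rcases hun w with hw | hw
  · exact key hA hB hun hqB hrA hz hc w hw hwq
  · rw [pair_comm]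
    exact key hB hA (fun x => (hun x).symm) hrA hqB hz.symm (inter_comm A B ▸ hc) w hw hwr

theorem IsContinuum.isPreconnected_compl (H1 : PointsNonblocking X) (H2 : PairsBlocking X)
    {A : Set X} (hA : IsContinuum A) : IsPreconnected Aᶜ := by
  by_contra h
  obtain ⟨U, V, hU, hV, ⟨u, hu⟩, ⟨v, hv⟩, hd, hUV⟩ := hA.1.isOpen_compl.exists_separation h
  have hAU : Disjoint A U := disjoint_left.2 fun x hxA hxU => (hUV ▸ Or.inl hxU : x ∈ Aᶜ) hxA
  have hAV : Disjoint A V := disjoint_left.2 fun x hxA hxV => (hUV ▸ Or.inr hxV : x ∈ Aᶜ) hxA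
  have hun : ∀ x, x ∈ A ∨ x ∈ U ∨ x ∈ V := fun x => by
    by_cases hx : x ∈ A
    · exact Or.inl hx
    · exact Or.inr (hUV.symm ▸ (hx : x ∈ Aᶜ) : x ∈ U ∪ V)
  have key : ∀ {U V : Set X}, IsOpen U → IsOpen V → Disjoint U V → U ∪ V = Aᶜ → Disjoint A V →
      IsContinuum (A ∪ U) := by
    intro U V hU hV hd hUV hAV
    have h1 : IsPreconnected (A ∪ U) := isPreconnected_univ.union_of_diff_eq (subset_univ A)
      hA.2.isPreconnected hA.2.nonempty hU hV hd (by rw [hUV, compl_eq_univ_sdiff])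
    refine ⟨?_, hA.2.nonempty.mono subset_union_left, h1⟩
    have : A ∪ U = Vᶜ := by
      ext x
      constructor
      · rintro (hx | hx)
        · exact disjoint_left.1 hAV hx
        · exact disjoint_left.1 hd hx
      · intro hx
        by_cases hxA : x ∈ A
        · exact Or.inl hxA
        · exact Or.inr ((hUV.symm ▸ (hxA : x ∈ Aᶜ) : x ∈ U ∪ V).resolve_right hx)
    rw [this]
    exact hV.isClosed_compl
  refine (key hU hV hd hUV hAV).not_isConnected_inter H1 H2
    (key hV hU hd.symm (union_comm U V ▸ hUV) hAU) ?_ ?_ ?_ ?_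
  · ext x; simpa using by rcases hun x with h | h | h <;> simp [h]
  · exact (ne_univ_iff_exists_notMem _).2 ⟨v, fun h => h.elim
      (fun h => disjoint_left.1 hAV h hv) (fun h => disjoint_left.1 hd h hv)⟩
  · exact (ne_univ_iff_exists_notMem _).2 ⟨u, fun h => h.elim
      (fun h => disjoint_left.1 hAU h hu) (fun h => disjoint_left.1 hd hu h)⟩
  · rw [← union_inter_distrib_left, hd.inter_eq, union_empty]
    exact hA.2

theorem IsContinuum.closure_compl (H1 : PointsNonblocking X) (H2 : PairsBlocking X)
    {A : Set X} (hA : IsContinuum A) (h : A ≠ univ) : IsContinuum (closure Aᶜ) :=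
  IsContinuum.closure_of_isConnected ⟨nonempty_compl.2 h, hA.isPreconnected_compl H1 H2⟩

omit [ConnectedSpace X] in
theorem exists_isContinuum_ne_univ_interior_nonempty [SecondCountableTopology X] [Nontrivial X]
    (H1 : PointsNonblocking X) (H2 : PairsBlocking X) :
    ∃ A : Set X, IsContinuum A ∧ A ≠ univ ∧ (interior A).Nonempty := by
  by_contra! hcon
  obtain ⟨p⟩ : Nonempty X := inferInstance
  have hcount : Countable (TopologicalSpace.countableBasis X) :=
    (TopologicalSpace.countable_countableBasis X).to_subtype
  have hq : ∃ q : X, ∀ K, IsContinuum K → K ≠ univ → p ∈ K → q ∉ K := by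
    by_contra! hq
    obtain ⟨b, O, -, hO, hOne, hOb⟩ := isOpen_univ.exists_subset_closure_of_subset_iUnion
      (ι := TopologicalSpace.countableBasis X) (univ_nonempty (α := X))
      (F := fun b => connectedComponentIn (b : Set X)ᶜ p) (by
        intro q _
        obtain ⟨K, hK, hKu, hp, hqK⟩ := hq q
        obtain ⟨x, hx⟩ := (ne_univ_iff_exists_notMem _).1 hKu
        obtain ⟨b, hb, hxb, hbK⟩ := (TopologicalSpace.isBasis_countableBasis X).exists_subset_of_mem_open
          (show x ∈ Kᶜ from hx) hK.1.isOpen_compl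
        refine mem_iUnion.2 ⟨⟨b, hb⟩, ?_⟩
        exact hK.2.isPreconnected.subset_connectedComponentIn hp (subset_compl_comm.1 hbK) hqK)
    have hbo := TopologicalSpace.isOpen_of_mem_countableBasis b.2
    have hbne := TopologicalSpace.nonempty_of_mem_countableBasis b.2
    have hcl : IsClosed (b : Set X)ᶜ := hbo.isClosed_compl
    rw [(hcl.isClosed_connectedComponentIn p).closure_eq] at hOb
    obtain ⟨o, ho⟩ := hOne
    have hp : p ∈ (b : Set X)ᶜ := by
      by_contra hp
      have := hOb ho
      rw [connectedComponentIn_eq_empty hp] at this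
      exact this
    have := hcon _ (hcl.isContinuum_connectedComponentIn hp) ?_
    · rw [eq_empty_iff_forall_notMem] at this
      exact this o (mem_interior.2 ⟨O, hOb, hO, ho⟩)
    · obtain ⟨y, hy⟩ := hbne
      exact (ne_univ_iff_exists_notMem _).2 ⟨y, fun h => connectedComponentIn_subset _ _ h hy⟩
  obtain ⟨q, hq⟩ := hq
  have hpq : p ≠ q := by
    rintro rfl
    obtain ⟨y, hy⟩ := exists_ne p
    exact hq {p} (isContinuum_singleton p)
      ((ne_univ_iff_exists_notMem _).2 ⟨y, hy⟩) rfl rfl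
  obtain ⟨x, hx, hd⟩ := H2 p q hpq
  have hxp : x ≠ p := fun h => hx (by simp [h])
  have hxq : x ≠ q := fun h => hx (by simp [h])
  have hun : ∀ K M : Set X, IsContinuum K → K ≠ univ → IsContinuum M → M ≠ univ →
      K ∪ M ≠ univ := by
    intro K M hK hKu hM hMu h
    have h1 := interior_union_isClosed_of_interior_empty hK.1 (hcon M hM hMu)
    rw [h, interior_univ, hcon K hK hKu] at h1
    exact univ_nonempty.ne_empty h1
  by_cases hxK : ∃ K, IsContinuum K ∧ K ≠ univ ∧ p ∈ K ∧ x ∈ K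
  · obtain ⟨K, hK, hKu, hpK, hxK⟩ := hxK
    refine hd ((H1 p x hxp).mono ?_)
    rintro y ⟨M, hM, hxM, hyM, hMp⟩
    rw [disjoint_singleton_right] at hMp
    refine ⟨M, hM, hxM, hyM, disjoint_left.2 ?_⟩
    rintro z hz (rfl | rfl)
    · exact hMp hz
    · exact hq _ (hK.union hM ⟨x, hxK, hxM⟩) (hun K M hK hKu hM
        ((ne_univ_iff_exists_notMem _).2 ⟨p, hMp⟩)) (Or.inl hpK) (Or.inr hz)
  · refine hd ((H1 q x hxq).mono ?_)
    rintro y ⟨M, hM, hxM, hyM, hMq⟩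
    rw [disjoint_singleton_right] at hMq
    refine ⟨M, hM, hxM, hyM, disjoint_left.2 ?_⟩
    rintro z hz (rfl | rfl)
    · exact hxK ⟨M, hM, (ne_univ_iff_exists_notMem _).2 ⟨q, hMq⟩, hz, hxM⟩
    · exact hMq hz

end CompactConnected

section CompactConnected

variable {X : Type*} [TopologicalSpace X] [T2Space X] [CompactSpace X] [ConnectedSpace X]

omit [CompactSpace X] in
theorem IsOpen.exists_disjoint_open_subsets [Nontrivial X] {O : Set X} (hO : IsOpen O)
    (hne : O.Nonempty) : ∃ U V : Set X, IsOpen U ∧ IsOpen V ∧ U.Nonempty ∧ V.Nonempty ∧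
      U ⊆ O ∧ V ⊆ O ∧ Disjoint U V := by
  obtain ⟨x, hx⟩ := hne
  obtain ⟨y, hy, hyx⟩ := (dense_compl_singleton x).exists_mem_open hO ⟨x, hx⟩
  obtain ⟨u, v, hu, hv, hxu, hyv, hd⟩ := t2_separation (Ne.symm hy)
  exact ⟨O ∩ u, O ∩ v, hO.inter hu, hO.inter hv, ⟨x, hx, hxu⟩, ⟨y, hyx, hyv⟩, inter_subset_left,
    inter_subset_left, hd.mono inter_subset_right inter_subset_right⟩

/-- Any two continua with nonempty interiors intersect. -/
def FatContinuaMeet (X : Type*) [TopologicalSpace X] : Prop :=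
  ∀ A B : Set X, IsContinuum A → IsContinuum B → (interior A).Nonempty → (interior B).Nonempty →
    (A ∩ B).Nonempty

omit [T2Space X] [CompactSpace X] [ConnectedSpace X] in
theorem FatContinuaMeet.joinedOff (J : FatContinuaMeet X) {A K F : Set X} {a w : X}
    (hA : IsContinuum A) (ha : a ∈ interior A) (hAF : Disjoint A F) (hK : IsContinuum K)
    (hKi : (interior K).Nonempty) (hKF : Disjoint K F) (hw : w ∈ K) : JoinedOff F w a :=
  ⟨K ∪ A, hK.union hA (J K A hK hA hKi ⟨a, ha⟩), Or.inl hw, Or.inr (interior_subset ha),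
    hKF.union_left hAF⟩

theorem disjoint_pair_right {α : Type*} {A : Set α} {p q : α} (hp : p ∉ A) (hq : q ∉ A) :
    Disjoint A {p, q} := by
  refine disjoint_left.2 ?_
  rintro x hx (rfl | rfl)
  · exact hp hx
  · exact hq hx

omit [CompactSpace X] in
theorem PairsBlocking.exists_not_joinedOff (H2 : PairsBlocking X) {A : Set X} {a q r : X}
    (hA : IsContinuum A) (ha : a ∈ interior A) (hq : q ∉ A) (hr : r ∉ A) (hqr : q ≠ r) :
    ∃ x, x ≠ q ∧ x ≠ r ∧ x ∉ A ∧ ¬ JoinedOff {q, r} x a := by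
  by_contra! h
  refine H2.not_forall_joinedOff (z := a) hqr fun w hwq hwr => ?_
  by_cases hwA : w ∈ A
  · exact ⟨A, hA, hwA, interior_subset ha, disjoint_pair_right hq hr⟩
  · exact h w hwq hwr hwA

theorem exists_continuum_separating_pair_from_blocked [SecondCountableTopology X]
    (H1 : PointsNonblocking X) (H2 : PairsBlocking X) {A : Set X} {a : X}
    (hA : IsContinuum A) (ha : a ∈ interior A) {U V : Set X} (hU : IsOpen U) (hV : IsOpen V)
    (hUn : U.Nonempty) (hVn : V.Nonempty) (hUA : Disjoint U A) (hVA : Disjoint V A)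
    (hUV : Disjoint U V) :
    ∃ q ∈ U, ∃ r ∈ V, ∃ x, x ∉ A ∧ ¬ JoinedOff {q, r} x a ∧
      ∃ M, IsContinuum M ∧ q ∈ interior M ∧ r ∈ interior M ∧ x ∉ M := by
  have hcount : Countable (TopologicalSpace.countableBasis X) :=
    (TopologicalSpace.countable_countableBasis X).to_subtype
  have haA : a ∈ A := interior_subset ha
  set F : TopologicalSpace.countableBasis X → Set (X × X) := fun b =>
    {z | (∃ x ∈ (b : Set X), x ∉ A ∧ ¬ JoinedOff {z.1, z.2} x a) ∧
      z ∈ connectedComponentIn (b : Set X)ᶜ a ×ˢ connectedComponentIn (b : Set X)ᶜ a} with hF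
  obtain ⟨b, O, hOs, hO, ⟨z, hz⟩, hOF⟩ := (hU.prod hV).exists_subset_closure_of_subset_iUnion
    (hUn.prod hVn) (F := F) (by
      rintro ⟨q, r⟩ ⟨hq, hr⟩
      dsimp only at hq hr
      have hqA := disjoint_left.1 hUA hq
      have hrA := disjoint_left.1 hVA hr
      obtain ⟨x, hxq, hxr, hxA, hx⟩ := H2.exists_not_joinedOff hA ha hqA hrA
        (fun h => disjoint_left.1 hUV hq (h ▸ hr))
      obtain ⟨K, hK, hqK, haK, hKx⟩ := H1.joinedOff_of_interior hA ⟨a, ha⟩ hxA haA hxq.symm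
      obtain ⟨K', hK', hrK', haK', hKx'⟩ := H1.joinedOff_of_interior hA ⟨a, ha⟩ hxA haA hxr.symm
      have hc : IsContinuum (K ∪ K') := hK.union hK' ⟨a, haK, haK'⟩
      have hx' : x ∈ (K ∪ K')ᶜ := disjoint_singleton_right.1 (hKx.union_left hKx')
      obtain ⟨b, hb, hxb, hbK⟩ :=
        (TopologicalSpace.isBasis_countableBasis X).exists_subset_of_mem_open hx' hc.1.isOpen_compl
      have := hc.2.isPreconnected.subset_connectedComponentIn (Or.inl haK)
        (subset_compl_comm.1 hbK)
      exact mem_iUnion.2 ⟨⟨b, hb⟩, ⟨x, hxb, hxA, hx⟩, this (Or.inl hqK), this (Or.inr hrK')⟩)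
  have hbo := TopologicalSpace.isOpen_of_mem_countableBasis b.2
  have hcl := hbo.isClosed_compl.isClosed_connectedComponentIn a
  set M := connectedComponentIn (b : Set X)ᶜ a
  have hOM : O ⊆ M ×ˢ M := hOF.trans
    (closure_minimal (fun z hz => hz.2) (hcl.prod hcl))
  obtain ⟨⟨q, r⟩, hqr, ⟨x, hxb, hxA, hx⟩, hq, hr⟩ := mem_closure_iff.1 (hOF hz) O hO hz
  obtain ⟨u, v, hu, hv, hqu, hrv, huv⟩ := isOpen_prod_iff.1 hO q r hqr
  have hab : a ∈ (b : Set X)ᶜ := by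
    by_contra hab
    rw [connectedComponentIn_eq_empty hab] at hq
    exact hq
  refine ⟨q, (hOs hqr).1, r, (hOs hqr).2, x, hxA, hx, M,
    hbo.isClosed_compl.isContinuum_connectedComponentIn hab, ?_, ?_, ?_⟩
  · exact mem_interior.2 ⟨u, fun y hy => (hOM (huv (mk_mem_prod hy hrv))).1, hu, hqu⟩
  · exact mem_interior.2 ⟨v, fun y hy => (hOM (huv (mk_mem_prod hqu hy))).2, hv, hrv⟩
  · exact fun h => connectedComponentIn_subset _ _ h hxb

theorem exists_continua_covering [SecondCountableTopology X] [Nontrivial X]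
    (H1 : PointsNonblocking X) (H2 : PairsBlocking X) {A : Set X} {a : X}
    (hA : IsContinuum A) (ha : a ∈ interior A) (hAu : A ≠ univ) :
    ∃ N N' U V : Set X, IsContinuum N ∧ IsContinuum N' ∧ N ∪ N' = univ ∧ IsOpen U ∧ IsOpen V ∧
      U.Nonempty ∧ V.Nonempty ∧ Disjoint U A ∧ Disjoint V A ∧ Disjoint U N ∧ Disjoint V N' := by
  obtain ⟨q, hq⟩ := (ne_univ_iff_exists_notMem _).1 hAu
  set B : Set (Set X) := {b ∈ TopologicalSpace.countableBasis X | q ∈ b}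
  have hcount : Countable B :=
    ((TopologicalSpace.countable_countableBasis X).mono (sep_subset _ _)).to_subtype
  have hAo : IsOpen Aᶜ := hA.1.isOpen_compl
  obtain ⟨r, hrq, hrA⟩ := (dense_compl_singleton q).exists_mem_open hAo ⟨q, hq⟩
  obtain ⟨b, O, hOs, hO, hOne, hOF⟩ := (hAo.inter
      (isOpen_compl_singleton (x := q))).exists_subset_closure_of_subset_iUnion
    ⟨r, hrA, hrq⟩ (F := fun b : B => connectedComponentIn (b : Set X)ᶜ a) (by
      rintro w ⟨hwA, hwq⟩
      obtain ⟨K, hK, hwK, haK, hKq⟩ :=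
        H1.joinedOff_of_interior hA ⟨a, ha⟩ hq (interior_subset ha) hwq
      obtain ⟨b, hb, hqb, hbK⟩ :=
        (TopologicalSpace.isBasis_countableBasis X).exists_subset_of_mem_open
          (disjoint_singleton_right.1 hKq : q ∈ Kᶜ) hK.1.isOpen_compl
      exact mem_iUnion.2 ⟨⟨b, hb, hqb⟩, hK.2.isPreconnected.subset_connectedComponentIn haK
        (subset_compl_comm.1 hbK) hwK⟩)
  have hbo := TopologicalSpace.isOpen_of_mem_countableBasis b.2.1
  have hcl := hbo.isClosed_compl.isClosed_connectedComponentIn a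
  rw [hcl.closure_eq] at hOF
  have hab : a ∈ (b : Set X)ᶜ := by
    by_contra hab
    rw [connectedComponentIn_eq_empty hab] at hOF
    exact hOne.ne_empty (subset_empty_iff.1 hOF)
  have hL := hbo.isClosed_compl.isContinuum_connectedComponentIn hab
  have hsub : connectedComponentIn (b : Set X)ᶜ a ⊆ (b : Set X)ᶜ := connectedComponentIn_subset _ _
  set L := connectedComponentIn (b : Set X)ᶜ a
  refine ⟨closure Lᶜ, L, O, b ∩ Aᶜ, hL.closure_compl H1 H2
    ((ne_univ_iff_exists_notMem _).2 ⟨q, fun h => hsub h b.2.2⟩), hL, ?_, hO, hbo.inter hAo, hOne,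
    ⟨q, b.2.2, hq⟩, ?_, ?_, ?_, ?_⟩
  · rw [eq_univ_iff_forall]
    intro x
    by_cases hx : x ∈ L
    · exact Or.inr hx
    · exact Or.inl (subset_closure hx)
  · exact disjoint_left.2 fun x hx => (hOs hx).1
  · exact disjoint_left.2 fun x hx => hx.2
  · rw [closure_compl]
    exact disjoint_left.2 fun x hx h => h (mem_interior.2 ⟨O, hOF, hO, hx⟩)
  · exact disjoint_left.2 fun x hx h => hsub h hx.1

theorem FatContinuaMeet.exists_fat_continuum_avoiding (J : FatContinuaMeet X)
    (H1 : PointsNonblocking X) (H2 : PairsBlocking X) {M N : Set X} {q r x y : X}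
    (hM : IsContinuum M) (hN : IsContinuum N) (hq : q ∈ interior M) (hr : r ∈ interior M)
    (hqN : q ∉ N) (hrN : r ∉ N) (hxM : x ∉ M) (hyN : y ∈ interior N) :
    ∃ D, IsContinuum D ∧ q ∈ interior D ∧ r ∈ interior D ∧ x ∉ D ∧ y ∉ D := by
  have h1 := hM.closure_compl H1 H2 ((ne_univ_iff_exists_notMem _).2 ⟨x, hxM⟩)
  have hsub : Mᶜ ⊆ interior (closure Mᶜ) := interior_maximal subset_closure hM.1.isOpen_compl
  have hE : IsContinuum (closure Mᶜ ∪ N) := h1.union hN (J _ _ h1 hN ⟨x, hsub hxM⟩ ⟨y, hyN⟩)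
  have hmem : ∀ z ∈ interior M, z ∉ N → z ∈ (closure Mᶜ ∪ N)ᶜ := by
    rintro z hz hzN (h | h)
    · rw [_root_.closure_compl] at h
      exact h hz
    · exact hzN h
  have hint : (closure Mᶜ ∪ N)ᶜ ⊆ interior (closure (closure Mᶜ ∪ N)ᶜ) :=
    interior_maximal subset_closure hE.1.isOpen_compl
  refine ⟨closure (closure Mᶜ ∪ N)ᶜ, hE.closure_compl H1 H2
    ((ne_univ_iff_exists_notMem _).2 ⟨q, hmem q hq hqN⟩), hint (hmem q hq hqN),
    hint (hmem r hr hrN), ?_, ?_⟩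
  · rw [_root_.closure_compl]
    exact fun h => h (interior_mono subset_union_left (hsub hxM))
  · rw [_root_.closure_compl]
    exact fun h => h (interior_mono subset_union_right hyN)

omit [ConnectedSpace X] in
theorem FatContinuaMeet.exists_continuum_through (J : FatContinuaMeet X)
    (H1 : PointsNonblocking X) {A D : Set X} {a d x y w : X} (hA : IsContinuum A)
    (ha : a ∈ interior A) (hxA : x ∉ A) (hyA : y ∉ A) (hD : IsContinuum D) (hd : d ∈ interior D)
    (hxD : x ∉ D) (hyD : y ∉ D) (hwy : w ≠ y) (hw : ¬ JoinedOff {x, y} w a) :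
    ∃ C, IsContinuum C ∧ w ∈ C ∧ x ∈ C ∧ Disjoint C (interior D) := by
  have hAxy := disjoint_pair_right hxA hyA
  have hwD : w ∉ D := fun h =>
    hw (J.joinedOff hA ha hAxy hD ⟨d, hd⟩ (disjoint_pair_right hxD hyD) h)
  obtain ⟨K, hK, hwK, hdK, hKy⟩ :=
    H1.joinedOff_of_interior hD ⟨d, hd⟩ hyD (interior_subset hd) hwy
  obtain ⟨C, hC, hwC, hCs, hCD⟩ := hK.exists_inter_of_subset_union (A := (interior D)ᶜ) (F := D)
    isOpen_interior.isClosed_compl hD.1 (fun z _ => by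
      by_cases hz : z ∈ D
      · exact Or.inr hz
      · exact Or.inl fun h => hz (interior_subset h)) hwK (fun h => hwD (interior_subset h))
    ⟨d, hdK, interior_subset hd⟩
  refine ⟨C, hC, hwC, ?_, disjoint_left.2 fun z hz => (hCs hz).2⟩
  by_contra hxC
  refine hw (J.joinedOff hA ha hAxy (hC.union hD hCD)
    ⟨d, interior_mono subset_union_right hd⟩ ?_ (Or.inl hwC))
  exact (disjoint_pair_right hxC fun h => disjoint_left.1 hKy (hCs h).1 rfl).union_left
    (disjoint_pair_right hxD hyD)

theorem not_fatContinuaMeet [SecondCountableTopology X] [Nontrivial X]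
    (H1 : PointsNonblocking X) (H2 : PairsBlocking X) : ¬ FatContinuaMeet X := by
  intro J
  obtain ⟨A, hA, hAu, a, ha⟩ := exists_isContinuum_ne_univ_interior_nonempty H1 H2
  obtain ⟨N, N', U, V, hN, hN', hNN, hU, hV, hUn, hVn, hUA, hVA, hUN, hVN⟩ :=
    exists_continua_covering H1 H2 hA ha hAu
  have hUi : U ⊆ interior N' := interior_maximal (fun z hz =>
    (hNN ▸ mem_univ z : z ∈ N ∪ N').resolve_left (disjoint_left.1 hUN hz)) hU
  have hVi : V ⊆ interior N := interior_maximal (fun z hz =>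
    (hNN ▸ mem_univ z : z ∈ N ∪ N').resolve_right (disjoint_left.1 hVN hz)) hV
  have key : ∀ {U N : Set X}, IsOpen U → U.Nonempty → Disjoint U A → Disjoint U N →
      IsContinuum N → (interior N).Nonempty →
      ∃ q r x M, q ∉ A ∧ r ∉ A ∧ q ∉ N ∧ r ∉ N ∧ x ∉ A ∧ x ∉ N ∧ ¬ JoinedOff {q, r} x a ∧
      IsContinuum M ∧ q ∈ interior M ∧ r ∈ interior M ∧ x ∉ M := by
    intro U N hU hUn hUA hUN hN hNi
    obtain ⟨U₁, U₂, h1, h2, h3, h4, h5, h6, h7⟩ := hU.exists_disjoint_open_subsets hUn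
    obtain ⟨q, hq, r, hr, x, hxA, hx, M, hM, hqM, hrM, hxM⟩ :=
      exists_continuum_separating_pair_from_blocked H1 H2 hA ha h1 h2 h3 h4
        (hUA.mono_left h5) (hUA.mono_left h6) h7
    have hqA := disjoint_left.1 hUA (h5 hq)
    have hrA := disjoint_left.1 hUA (h6 hr)
    have hqN := disjoint_left.1 hUN (h5 hq)
    have hrN := disjoint_left.1 hUN (h6 hr)
    exact ⟨q, r, x, M, hqA, hrA, hqN, hrN, hxA, fun h => hx (J.joinedOff hA ha
      (disjoint_pair_right hqA hrA) hN hNi (disjoint_pair_right hqN hrN) h), hx, hM, hqM, hrM, hxM⟩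
  obtain ⟨q, r, x, M, hqA, hrA, hqN, hrN, hxA, hxN, hx, hM, hqM, hrM, hxM⟩ :=
    key hU hUn hUA hUN hN (hVn.mono hVi)
  obtain ⟨q', r', y, M', hqA', hrA', hqN', hrN', hyA, hyN, hy, hM', hqM', hrM', hyM'⟩ :=
    key hV hVn hVA hVN hN' (hUn.mono hUi)
  have hxi : x ∈ interior N' := mem_interior.2 ⟨Nᶜ, fun z hz =>
    (hNN ▸ mem_univ z : z ∈ N ∪ N').resolve_left hz, hN.1.isOpen_compl, hxN⟩
  have hyi : y ∈ interior N := mem_interior.2 ⟨N'ᶜ, fun z hz =>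
    (hNN ▸ mem_univ z : z ∈ N ∪ N').resolve_right hz, hN'.1.isOpen_compl, hyN⟩
  obtain ⟨D, hD, hqD, hrD, hxD, hyD⟩ :=
    J.exists_fat_continuum_avoiding H1 H2 hM hN hqM hrM hqN hrN hxM hyi
  obtain ⟨D', hD', hqD', hrD', hyD', hxD'⟩ :=
    J.exists_fat_continuum_avoiding H1 H2 hM' hN' hqM' hrM' hqN' hrN' hyM' hxi
  have hxy : x ≠ y := fun h => hxN (h ▸ interior_subset hyi)
  obtain ⟨w, hwx, hwy, -, hw⟩ := H2.exists_not_joinedOff hA ha hxA hyA hxy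
  obtain ⟨C, hC, hwC, hxC, hCD⟩ :=
    J.exists_continuum_through H1 hA ha hxA hyA hD hqD hxD hyD hwy hw
  obtain ⟨C', hC', hwC', hyC', hCD'⟩ :=
    J.exists_continuum_through H1 hA ha hyA hxA hD' hqD' hyD' hxD' hwx (pair_comm x y ▸ hw)
  have hwx' : JoinedOff {q, r} x w := ⟨C, hC, hxC, hwC, disjoint_pair_right
    (fun h => disjoint_left.1 hCD h hqD) (fun h => disjoint_left.1 hCD h hrD)⟩
  have hwy' : JoinedOff {q', r'} y w := ⟨C', hC', hyC', hwC', disjoint_pair_right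
    (fun h => disjoint_left.1 hCD' h hqD') (fun h => disjoint_left.1 hCD' h hrD')⟩
  rcases (hNN ▸ mem_univ w : w ∈ N ∪ N') with h | h
  · exact hx (hwx'.trans (J.joinedOff hA ha (disjoint_pair_right hqA hrA) hN (hVn.mono hVi)
      (disjoint_pair_right hqN hrN) h))
  · exact hy (hwy'.trans (J.joinedOff hA ha (disjoint_pair_right hqA' hrA') hN' (hUn.mono hUi)
      (disjoint_pair_right hqN' hrN') h))

end CompactConnected

section CompactConnected

theorem isPreconnected_iInter_of_antitone {X : Type*} [TopologicalSpace X] [T2Space X]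
    [CompactSpace X] {N : ℕ → Set X} (hN : Antitone N) (hc : ∀ n, IsClosed (N n))
    (hp : ∀ n, IsPreconnected (N n)) : IsPreconnected (⋂ n, N n) := by
  rw [isPreconnected_closed_iff]
  rintro t t' ht ht' hP ⟨x, hxP, hxt⟩ ⟨y, hyP, hyt⟩
  by_contra hne
  have hPc : IsClosed (⋂ n, N n) := isClosed_iInter hc
  have hd : Disjoint ((⋂ n, N n) ∩ t) ((⋂ n, N n) ∩ t') := disjoint_left.2
    fun z hz hz' => hne ⟨z, hz.1, hz.2, hz'.2⟩
  obtain ⟨u, v, hu, hv, htu, htv, huv⟩ := normal_separation (hPc.inter ht) (hPc.inter ht') hd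
  obtain ⟨n, hn⟩ := exists_subset_nhds_of_isCompact' (V := N) hN.directed_ge
    (fun n => (hc n).isCompact) hc (U := u ∪ v) (fun z hz => (hu.union hv).mem_nhds
      ((hP hz).imp (fun h => htu ⟨hz, h⟩) (fun h => htv ⟨hz, h⟩)))
  exact not_isPreconnected_of_disjoint hu hv huv hn
    ⟨x, mem_iInter.1 hxP n, htu ⟨hxP, hxt⟩⟩ ⟨y, mem_iInter.1 hyP n, htv ⟨hyP, hyt⟩⟩ (hp n)

variable {X : Type*} [TopologicalSpace X] [T2Space X] [CompactSpace X] [ConnectedSpace X]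

/-- A continuum with nonempty interior. -/
def IsFatContinuum (A : Set X) : Prop := IsContinuum A ∧ (interior A).Nonempty

omit [T2Space X] [CompactSpace X] in
theorem compl_union_nonempty {A B : Set X} (hA : IsFatContinuum A) (hB : IsFatContinuum B)
    (hAB : Disjoint A B) : ((A ∪ B)ᶜ).Nonempty := by
  by_contra hne
  rw [not_nonempty_iff_eq_empty, compl_empty_iff] at hne
  obtain ⟨a, ha⟩ := hA.1.2.nonempty
  obtain ⟨b, hb⟩ := hB.1.2.nonempty
  obtain ⟨x, -, hxA, hxB⟩ := isPreconnected_closed_iff.1 isPreconnected_univ A B hA.1.1 hB.1.1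
    hne.ge ⟨a, mem_univ _, ha⟩ ⟨b, mem_univ _, hb⟩
  exact disjoint_left.1 hAB hxA hxB

theorem not_isPreconnected_compl_union (H1 : PointsNonblocking X) (H2 : PairsBlocking X)
    {A B : Set X} (hA : IsFatContinuum A) (hB : IsFatContinuum B) (hAB : Disjoint A B) :
    ¬ IsPreconnected (A ∪ B)ᶜ := by
  intro hpre
  obtain ⟨z, hz⟩ := compl_union_nonempty hA hB hAB
  have hM := IsContinuum.closure_of_isConnected ⟨⟨z, hz⟩, hpre⟩
  have hzM := subset_closure hz
  obtain ⟨q, hq⟩ := hA.2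
  obtain ⟨r, hr⟩ := hB.2
  have hqM : q ∉ closure (A ∪ B)ᶜ := by
    rw [closure_compl]
    exact fun h => h (interior_mono subset_union_left hq)
  have hrM : r ∉ closure (A ∪ B)ᶜ := by
    rw [closure_compl]
    exact fun h => h (interior_mono subset_union_right hr)
  have hcov : ∀ w, w ∈ A ∨ w ∈ B ∨ w ∈ closure (A ∪ B)ᶜ := fun w => by
    by_cases hwA : w ∈ A
    · exact Or.inl hwA
    · by_cases hwB : w ∈ B
      · exact Or.inr (Or.inl hwB)
      · exact Or.inr (Or.inr (subset_closure fun h => h.elim hwA hwB))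
  generalize closure (A ∪ B)ᶜ = M at hM hzM hqM hrM hcov
  have key : ∀ {A B : Set X} {q r : X}, IsFatContinuum A → IsFatContinuum B → Disjoint A B →
      q ∈ A → r ∈ B → q ∉ M → r ∉ M → (∀ w, w ∈ A ∨ w ∈ B ∨ w ∈ M) → ∀ w ∈ A, w ≠ q →
      JoinedOff {q, r} w z := by
    intro A B q r hA hB hAB hq hr hqM hrM hcov w hwA hwq
    have hqB := disjoint_left.1 hAB hq
    obtain ⟨K, hK, hwK, hrK, hKq⟩ := H1.joinedOff_of_interior hB.1 hB.2 hqB hr hwq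
    obtain ⟨C, hC, hwC, hCs, y, hyC, hy⟩ := hK.exists_inter_of_subset_union (F := B ∪ M) hA.1.1
      (hB.1.1.union hM.1) (fun x _ => hcov x) hwK hwA ⟨r, hrK, Or.inl hr⟩
    have hyM : y ∈ M := hy.resolve_left (disjoint_left.1 hAB (hCs hyC).2)
    exact ⟨C ∪ M, hC.union hM ⟨y, hyC, hyM⟩, Or.inl hwC, Or.inr hzM,
      (disjoint_pair_right (fun h => disjoint_left.1 hKq (hCs h).1 rfl)
        (fun h => disjoint_left.1 hAB (hCs h).2 hr)).union_left (disjoint_pair_right hqM hrM)⟩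
  have hqA := interior_subset hq
  have hrB := interior_subset hr
  refine H2.not_forall_joinedOff (z := z)
    (fun h => disjoint_left.1 hAB hqA (h ▸ hrB) : q ≠ r) fun w hwq hwr => ?_
  rcases hcov w with h | h | h
  · exact key hA hB hAB hqA hrB hqM hrM hcov w h hwq
  · rw [pair_comm]
    exact key hB hA hAB.symm hrB hqA hrM hqM (fun w => or_left_comm.1 (hcov w)) w h hwr
  · exact ⟨M, hM, h, hzM, disjoint_pair_right hqM hrM⟩

theorem exists_preconnected_separation_compl_union (H1 : PointsNonblocking X)
    (H2 : PairsBlocking X) {A B : Set X} (hA : IsFatContinuum A) (hB : IsFatContinuum B)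
    (hAB : Disjoint A B) : ∃ U V : Set X, IsOpen U ∧ IsOpen V ∧ U.Nonempty ∧ V.Nonempty ∧
      Disjoint U V ∧ U ∪ V = (A ∪ B)ᶜ ∧ IsPreconnected U ∧ IsPreconnected V := by
  obtain ⟨U, V, hU, hV, hUn, hVn, hUV, h⟩ :=
    (hA.1.1.union hB.1.1).isOpen_compl.exists_separation
      (not_isPreconnected_compl_union H1 H2 hA hB hAB)
  have key : ∀ {U V : Set X}, IsOpen U → IsOpen V → U.Nonempty → Disjoint U V →
      U ∪ V = (A ∪ B)ᶜ → IsPreconnected V := by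
    intro U V hU hV hUn hUV h
    have hAU : IsPreconnected (A ∪ U) :=
      (hB.1.isPreconnected_compl H1 H2).union_of_diff_eq
        (fun x hx => disjoint_left.1 hAB hx) hA.1.2.isPreconnected hA.1.2.nonempty hU hV hUV
        (by rw [h]; ext x; simp only [Set.mem_sdiff, mem_compl_iff, mem_union]; tauto)
    have hBU : IsPreconnected (B ∪ U) :=
      (hA.1.isPreconnected_compl H1 H2).union_of_diff_eq
        (fun x hx => disjoint_right.1 hAB hx) hB.1.2.isPreconnected hB.1.2.nonempty hU hV hUV
        (by rw [h]; ext x; simp only [Set.mem_sdiff, mem_compl_iff, mem_union]; tauto)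
    obtain ⟨u, hu⟩ := hUn
    have h3 := hAU.union u (Or.inr hu) (Or.inr hu) hBU
    have h4 : Vᶜ = A ∪ U ∪ (B ∪ U) := by
      ext x
      have h5 : x ∈ U ∪ V ↔ x ∈ (A ∪ B)ᶜ := by rw [h]
      have h6 : x ∈ U → x ∉ V := fun h => disjoint_left.1 hUV h
      simp only [mem_compl_iff, mem_union] at h5 ⊢
      tauto
    have h5 : IsContinuum Vᶜ := ⟨hV.isClosed_compl, h4 ▸ ⟨u, Or.inl (Or.inr hu)⟩, h4 ▸ h3⟩
    simpa using h5.isPreconnected_compl H1 H2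
  exact ⟨U, V, hU, hV, hUn, hVn, hUV, h, key hV hU hVn hUV.symm (by rw [union_comm, h]),
    key hU hV hUn hUV h⟩

theorem IsContinuum.subset_or_subset_of_meets (H1 : PointsNonblocking X) (H2 : PairsBlocking X)
    {A B L U V : Set X} (hA : IsContinuum A) (hB : IsContinuum B) (hL : IsContinuum L)
    (hAL : (A ∩ L).Nonempty) (hBL : (B ∩ L).Nonempty) (hU : IsOpen U) (hV : IsOpen V)
    (hUV : Disjoint U V) (h : U ∪ V = (A ∪ B)ᶜ) : U ⊆ L ∨ V ⊆ L := by
  obtain ⟨b, hb, hbL⟩ := hBL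
  have hE : IsContinuum (A ∪ L ∪ B) := (hA.union hL hAL).union hB ⟨b, Or.inr hbL, hb⟩
  by_contra! hcon
  obtain ⟨x, hxU, hxL⟩ := not_subset.1 hcon.1
  obtain ⟨y, hyV, hyL⟩ := not_subset.1 hcon.2
  have hmem : ∀ z, z ∈ U ∨ z ∈ V ↔ z ∉ A ∧ z ∉ B := fun z => by
    have h5 : z ∈ U ∪ V ↔ z ∈ (A ∪ B)ᶜ := by rw [h]
    simpa using h5
  refine not_isPreconnected_of_disjoint hU hV hUV (S := (A ∪ L ∪ B)ᶜ) ?_ ⟨x, ?_, hxU⟩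
    ⟨y, ?_, hyV⟩ (hE.isPreconnected_compl H1 H2)
  · intro z hz
    have := hmem z
    simp only [mem_compl_iff, mem_union] at hz ⊢
    tauto
  · have := hmem x
    simp only [mem_compl_iff, mem_union]
    tauto
  · have := hmem y
    simp only [mem_compl_iff, mem_union]
    tauto

theorem connectedComponentIn_separation (H1 : PointsNonblocking X) (H2 : PairsBlocking X)
    {A B : Set X} (hA : IsFatContinuum A) (hB : IsFatContinuum B) (hAB : Disjoint A B) {x y : X}
    (hx : x ∈ (A ∪ B)ᶜ) (hy : y ∈ (A ∪ B)ᶜ) (hxy : y ∉ connectedComponentIn (A ∪ B)ᶜ x) :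
    IsOpen (connectedComponentIn (A ∪ B)ᶜ x) ∧ IsOpen (connectedComponentIn (A ∪ B)ᶜ y) ∧
    Disjoint (connectedComponentIn (A ∪ B)ᶜ x) (connectedComponentIn (A ∪ B)ᶜ y) ∧
    connectedComponentIn (A ∪ B)ᶜ x ∪ connectedComponentIn (A ∪ B)ᶜ y = (A ∪ B)ᶜ := by
  obtain ⟨U, V, hU, hV, -, -, hUV, h, hUp, hVp⟩ :=
    exists_preconnected_separation_compl_union H1 H2 hA hB hAB
  have key : ∀ {U V : Set X} {x : X}, IsOpen U → IsOpen V → Disjoint U V → U ∪ V = (A ∪ B)ᶜ →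
      IsPreconnected U → x ∈ U → connectedComponentIn (A ∪ B)ᶜ x = U := by
    intro U V x hU hV hUV h hUp hx
    have hUs : U ⊆ (A ∪ B)ᶜ := h ▸ subset_union_left
    refine Subset.antisymm ?_ (hUp.subset_connectedComponentIn hx hUs)
    rcases isPreconnected_connectedComponentIn.subset_or_subset_of_disjoint hU hV hUV
      ((connectedComponentIn_subset (A ∪ B)ᶜ x).trans h.ge) with h1 | h1
    · exact h1
    · exact absurd (h1 (mem_connectedComponentIn (hUs hx))) (disjoint_left.1 hUV hx)
  have h' : V ∪ U = (A ∪ B)ᶜ := by rw [union_comm, h]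
  have hx' := h.ge hx
  have hy' := h.ge hy
  rcases hx' with hxU | hxV
  · have e1 := key hU hV hUV h hUp hxU
    rcases hy' with hyU | hyV
    · exact absurd (e1.ge hyU) hxy
    · have e2 := key hV hU hUV.symm h' hVp hyV
      rw [e1, e2]
      exact ⟨hU, hV, hUV, h⟩
  · have e1 := key hV hU hUV.symm h' hVp hxV
    rcases hy' with hyU | hyV
    · have e2 := key hU hV hUV h hUp hyU
      rw [e1, e2]
      exact ⟨hV, hU, hUV.symm, h'⟩
    · exact absurd (e1.ge hyV) hxy

theorem notMem_connectedComponentIn_of_subset (H1 : PointsNonblocking X) (H2 : PairsBlocking X)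
    {A B N : Set X} (hA : IsFatContinuum A) (hB : IsFatContinuum B) (hAB : Disjoint A B)
    (hN : IsFatContinuum N) (hNA : N ⊆ A) {x y : X}
    (hx : x ∈ (A ∪ B)ᶜ) (hy : y ∈ (A ∪ B)ᶜ) (hxy : y ∉ connectedComponentIn (A ∪ B)ᶜ x) :
    y ∉ connectedComponentIn (N ∪ B)ᶜ x := by
  intro hcon
  have hNB := hAB.mono_left hNA
  have hsub : (A ∪ B)ᶜ ⊆ (N ∪ B)ᶜ := compl_subset_compl.2 (union_subset_union_left B hNA)
  obtain ⟨-, -, -, hun⟩ := connectedComponentIn_separation H1 H2 hA hB hAB hx hy hxy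
  obtain ⟨U, V, hU, hV, hUn, hVn, hUV, h⟩ := (hN.1.1.union hB.1.1).isOpen_compl.exists_separation
      (not_isPreconnected_compl_union H1 H2 hN hB hNB)
  have key : ∀ {U V : Set X}, IsOpen U → IsOpen V → V.Nonempty → Disjoint U V →
      U ∪ V = (N ∪ B)ᶜ → connectedComponentIn (N ∪ B)ᶜ x ⊆ U → False := by
    intro U V hU hV hVn hUV h hc
    have hxU : x ∈ U := hc (mem_connectedComponentIn (hsub hx))
    have hyU : y ∈ U := hc hcon
    have h1 : ∀ z ∈ U, z ∈ (A ∪ B)ᶜ → connectedComponentIn (A ∪ B)ᶜ z ⊆ U := by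
      intro z hzU hz
      rcases isPreconnected_connectedComponentIn.subset_or_subset_of_disjoint hU hV hUV
        (((connectedComponentIn_subset (A ∪ B)ᶜ z).trans hsub).trans h.ge) with h1 | h1
      · exact h1
      · exact absurd (h1 (mem_connectedComponentIn hz)) (disjoint_left.1 hUV hzU)
    have h2 : (A ∪ B)ᶜ ⊆ U := hun ▸ union_subset (h1 x hxU hx) (h1 y hyU hy)
    have h3 : IsPreconnected (B ∪ V) := (hN.1.isPreconnected_compl H1 H2).union_of_diff_eq
        (fun x hx => disjoint_right.1 hNB hx) hB.1.2.isPreconnected hB.1.2.nonempty hV hU hUV.symm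
        (by rw [union_comm V U, h]; ext x; simp only [Set.mem_sdiff, mem_compl_iff, mem_union]; tauto)
    obtain ⟨b, hb⟩ := hB.1.2.nonempty
    obtain ⟨v, hv⟩ := hVn
    have hVA : V ⊆ A := by
      intro z hz
      have h4 : z ∈ (N ∪ B)ᶜ := h ▸ Or.inr hz
      by_contra hzA
      exact disjoint_left.1 hUV (h2 fun h' => h'.elim hzA fun h' => h4 (Or.inr h')) hz
    obtain ⟨z, -, hzA, hzB⟩ := isPreconnected_closed_iff.1 h3 A B hA.1.1 hB.1.1
      (union_subset subset_union_right (hVA.trans subset_union_left)) ⟨v, Or.inr hv, hVA hv⟩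
      ⟨b, Or.inl hb, hb⟩
    exact disjoint_left.1 hAB hzA hzB
  rcases isPreconnected_connectedComponentIn.subset_or_subset_of_disjoint hU hV hUV
    ((connectedComponentIn_subset (N ∪ B)ᶜ x).trans h.ge) with h1 | h1
  · exact key hU hV hVn hUV h h1
  · exact key hV hU hUn hUV.symm (by rw [union_comm, h]) h1

end CompactConnected

section MetricContinua

variable {X : Type*} [MetricSpace X] [CompactSpace X] [ConnectedSpace X]

theorem exists_antitone_fat_continua (H1 : PointsNonblocking X) (H2 : PairsBlocking X)
    {A B : Set X} {p : X} (hA : IsContinuum A) (hp : p ∈ interior A) (hB : IsFatContinuum B)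
    (hAB : Disjoint A B) :
    ∃ N : ℕ → Set X, Antitone N ∧ (∀ n, IsContinuum (N n) ∧ p ∈ interior (N n) ∧ N n ⊆ A) ∧
      interior (⋂ n, N n) = ∅ := by
  obtain ⟨b, hb⟩ := hB.1.2.nonempty
  have hpB := disjoint_left.1 hAB (interior_subset hp)
  have hbA := disjoint_right.1 hAB hb
  have hpb : p ≠ b := fun h => hpB (h ▸ hb)
  have : Nontrivial X := ⟨p, b, hpb⟩
  obtain ⟨ε, hε, hball⟩ := Metric.isOpen_iff.1 isOpen_interior p hp
  obtain ⟨u, hu_anti, hu_pos, hu_lim⟩ := exists_seq_strictAnti_tendsto' hε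
  set L : ℕ → Set X := fun n => connectedComponentIn (ball p (u n))ᶜ b with hL
  have hAc := hA.closure_compl H1 H2 ((ne_univ_iff_exists_notMem _).2 ⟨b, hbA⟩)
  have hAcL : ∀ n, closure Aᶜ ⊆ L n := fun n =>
    hAc.2.isPreconnected.subset_connectedComponentIn (subset_closure hbA) (by
      rw [closure_compl, compl_subset_compl]
      exact (ball_subset_ball (hu_pos n).2.le).trans hball)
  have hLball : ∀ n, ball p (u n) ⊆ (L n)ᶜ := fun n =>
    subset_compl_comm.1 (connectedComponentIn_subset _ _)
  have hpL : ∀ n, p ∉ L n := fun n => hLball n (mem_ball_self (hu_pos n).1)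
  have hbL : ∀ n, b ∈ (ball p (u n))ᶜ := fun n =>
    connectedComponentIn_subset _ _ (hAcL n (subset_closure hbA))
  have hLc : ∀ n, IsContinuum (L n) := fun n =>
    isOpen_ball.isClosed_compl.isContinuum_connectedComponentIn (hbL n)
  refine ⟨fun n => closure (L n)ᶜ, ?_, fun n => ⟨?_, ?_, ?_⟩, ?_⟩
  · intro m n hmn
    exact closure_mono (compl_subset_compl.2 (connectedComponentIn_mono b
      (compl_subset_compl.2 (ball_subset_ball (hu_anti.antitone hmn)))))
  · exact (hLc n).closure_compl H1 H2 ((ne_univ_iff_exists_notMem _).2 ⟨p, hpL n⟩)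
  · exact interior_maximal subset_closure (hLc n).1.isOpen_compl (hpL n)
  · exact closure_minimal (compl_subset_comm.1 (subset_closure.trans (hAcL n))) hA.1
  · by_contra hne
    rw [← ne_eq, ← nonempty_iff_ne_empty] at hne
    obtain ⟨x, hxp, hxW⟩ := (dense_compl_singleton p).exists_mem_open isOpen_interior hne
    obtain ⟨n, O, hOs, hO, ⟨o, ho⟩, hOL⟩ := (isOpen_interior.inter
      (isOpen_compl_singleton (x := p))).exists_subset_closure_of_subset_iUnion
      ⟨x, hxW, hxp⟩ (F := L) (by
        rintro w ⟨-, hwp⟩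
        obtain ⟨K, hK, hwK, hbK, hKp⟩ := H1.joinedOff_of_interior hB.1 hB.2 hpB hb hwp
        obtain ⟨δ, hδ, hδK⟩ := Metric.isOpen_iff.1 hK.1.isOpen_compl p
          (disjoint_singleton_right.1 hKp)
        obtain ⟨n, hn⟩ := (hu_lim.eventually_lt_const hδ).exists
        refine mem_iUnion.2 ⟨n, hK.2.isPreconnected.subset_connectedComponentIn hbK ?_ hwK⟩
        exact subset_compl_comm.1 ((ball_subset_ball hn.le).trans hδK))
    rw [(hLc n).1.closure_eq] at hOL
    have h1 : o ∈ closure (L n)ᶜ := mem_iInter.1 (interior_subset (hOs ho).1) n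
    rw [closure_compl] at h1
    exact h1 (interior_maximal hOL hO ho)

theorem IsContinuum.exists_continuum_nhd_subset (H1 : PointsNonblocking X)
    (H2 : PairsBlocking X) {A B : Set X} {p : X} (hA : IsContinuum A) (hp : p ∈ interior A)
    (hB : IsFatContinuum B) (hAB : Disjoint A B) {O : Set X} (hO : IsOpen O) (hpO : p ∈ O) :
    ∃ N, IsContinuum N ∧ p ∈ interior N ∧ N ⊆ O := by
  obtain ⟨N, hanti, hN, hint⟩ := exists_antitone_fat_continua H1 H2 hA hp hB hAB
  have hfat : ∀ n, IsFatContinuum (N n) := fun n => ⟨(hN n).1, p, (hN n).2.1⟩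
  have hNB : ∀ n, Disjoint (N n) B := fun n => hAB.mono_left (hN n).2.2
  have hPB : Disjoint (⋂ n, N n) B := (hNB 0).mono_left (iInter_subset _ _)
  have hpP : p ∈ ⋂ n, N n := mem_iInter.2 fun n => interior_subset (hN n).2.1
  have hPpre := isPreconnected_iInter_of_antitone hanti (fun n => (hN n).1.1)
    (fun n => (hN n).1.2.isPreconnected)
  have hPcl : IsClosed (⋂ n, N n) := isClosed_iInter fun n => (hN n).1.1
  obtain ⟨U₀, V₀, hU₀, hV₀, ⟨o₁, ho₁⟩, ⟨o₂, ho₂⟩, hUV₀, h₀⟩ :=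
    ((hN 0).1.1.union hB.1.1).isOpen_compl.exists_separation
      (not_isPreconnected_compl_union H1 H2 (hfat 0) hB (hNB 0))
  have ho₁' : o₁ ∈ (N 0 ∪ B)ᶜ := h₀ ▸ Or.inl ho₁
  have ho₂' : o₂ ∈ (N 0 ∪ B)ᶜ := h₀ ▸ Or.inr ho₂
  have h12 : o₂ ∉ connectedComponentIn (N 0 ∪ B)ᶜ o₁ := fun h =>
    not_isPreconnected_of_disjoint hU₀ hV₀ hUV₀
      ((connectedComponentIn_subset (N 0 ∪ B)ᶜ o₁).trans h₀.ge)
      ⟨o₁, mem_connectedComponentIn ho₁', ho₁⟩ ⟨o₂, h, ho₂⟩ isPreconnected_connectedComponentIn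
  have hΩ : Monotone fun n => (N n ∪ B)ᶜ := fun m n hmn =>
    compl_subset_compl.2 (union_subset_union_left B (hanti hmn))
  have hsep := fun n => connectedComponentIn_separation H1 H2 (hfat n) hB (hNB n)
    (hΩ (Nat.zero_le n) ho₁') (hΩ (Nat.zero_le n) ho₂')
    (notMem_connectedComponentIn_of_subset H1 H2 (hfat 0) hB (hNB 0) (hfat n)
      (hanti (Nat.zero_le n)) ho₁' ho₂' h12)
  set U : ℕ → Set X := fun n => connectedComponentIn (N n ∪ B)ᶜ o₁ with hU
  set V : ℕ → Set X := fun n => connectedComponentIn (N n ∪ B)ᶜ o₂ with hV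
  have hUmono : Monotone U := fun m n hmn => connectedComponentIn_mono _ (hΩ hmn)
  have hVmono : Monotone V := fun m n hmn => connectedComponentIn_mono _ (hΩ hmn)
  have hUo : IsOpen (⋃ n, U n) := isOpen_iUnion fun n => (hsep n).1
  have hVo : IsOpen (⋃ n, V n) := isOpen_iUnion fun n => (hsep n).2.1
  have hUVd : Disjoint (⋃ n, U n) (⋃ n, V n) := by
    refine disjoint_left.2 fun x hx hx' => ?_
    obtain ⟨m, hm⟩ := mem_iUnion.1 hx
    obtain ⟨n, hn⟩ := mem_iUnion.1 hx'
    exact disjoint_left.1 (hsep (max m n)).2.2.1 (hUmono (le_max_left m n) hm)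
      (hVmono (le_max_right m n) hn)
  have hcov : ∀ x, x ∉ B → x ∉ (⋂ n, N n) → x ∈ (⋃ n, U n) ∪ (⋃ n, V n) := by
    intro x hxB hxP
    obtain ⟨n, hn⟩ := not_forall.1 fun h => hxP (mem_iInter.2 h)
    have : x ∈ U n ∪ V n := (hsep n).2.2.2.ge fun h => h.elim hn hxB
    exact this.imp (fun h => mem_iUnion.2 ⟨n, h⟩) (fun h => mem_iUnion.2 ⟨n, h⟩)
  have hUB : ∀ x ∈ ⋃ n, U n, x ∉ B := fun x hx hxB => by
    obtain ⟨n, hn⟩ := mem_iUnion.1 hx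
    exact connectedComponentIn_subset _ _ hn (Or.inr hxB)
  have hVB : ∀ x ∈ ⋃ n, V n, x ∉ B := fun x hx hxB => by
    obtain ⟨n, hn⟩ := mem_iUnion.1 hx
    exact connectedComponentIn_subset _ _ hn (Or.inr hxB)
  have hoU : o₁ ∈ ⋃ n, U n := mem_iUnion.2 ⟨0, mem_connectedComponentIn ho₁'⟩
  have hoV : o₂ ∈ ⋃ n, V n := mem_iUnion.2 ⟨0, mem_connectedComponentIn ho₂'⟩
  have hdich : ∀ L, IsContinuum L → ((⋂ n, N n) ∩ L).Nonempty → (B ∩ L).Nonempty →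
      (⋃ n, U n) ⊆ L ∨ (⋃ n, V n) ⊆ L := by
    rintro L hL ⟨x, hxP, hxL⟩ hBL
    by_contra! hcon
    obtain ⟨y, hy, hyL⟩ := not_subset.1 hcon.1
    obtain ⟨z, hz, hzL⟩ := not_subset.1 hcon.2
    obtain ⟨m, hm⟩ := mem_iUnion.1 hy
    obtain ⟨n, hn⟩ := mem_iUnion.1 hz
    rcases (hN (max m n)).1.subset_or_subset_of_meets H1 H2 hB.1 hL
      ⟨x, mem_iInter.1 hxP _, hxL⟩ hBL (hsep _).1 (hsep _).2.1 (hsep _).2.2.1 (hsep _).2.2.2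
      with h | h
    · exact hyL (h (hUmono (le_max_left m n) hm))
    · exact hzL (h (hVmono (le_max_right m n) hn))
  generalize (⋃ n, U n) = U at *
  generalize (⋃ n, V n) = V at *
  have hclos : ∀ {U V : Set X} {o₁ o₂ : X}, IsOpen U → IsOpen V → Disjoint U V →
      (∀ x, x ∉ B → x ∉ (⋂ n, N n) → x ∈ U ∪ V) → o₁ ∈ U → o₂ ∈ V → o₁ ∉ B → o₂ ∉ B →
      ((⋂ n, N n) ∩ closure U).Nonempty := by
    intro U V o₁ o₂ hUo hVo hUVd hcov hoU hoV hUB hVB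
    by_contra hne
    have hVc : ∀ x ∈ V, x ∉ closure U := fun x hx => disjoint_left.1 (hUVd.symm.closure_right hVo) hx
    refine not_isPreconnected_of_disjoint (S := Bᶜ) hUo (V := (closure U)ᶜ)
      isClosed_closure.isOpen_compl (disjoint_compl_right.mono_left subset_closure) ?_
      ⟨o₁, hUB, hoU⟩ ⟨o₂, hVB, hVc _ hoV⟩ (hB.1.isPreconnected_compl H1 H2)
    intro x hx
    by_cases hxP : x ∈ ⋂ n, N n
    · exact Or.inr fun h => hne ⟨x, hxP, h⟩
    · exact (hcov x hx hxP).imp_right (hVc x)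
  have hPUV : (⋂ n, N n) ⊆ closure U ∪ closure V := by
    intro x hx
    rw [← closure_union, _root_.mem_closure_iff]
    intro W hW hxW
    by_contra hne
    have h1 : W ∩ Bᶜ ⊆ ⋂ n, N n := by
      rintro y ⟨hyW, hyB⟩
      by_contra hyP
      exact hne ⟨y, hyW, hcov y hyB hyP⟩
    have h2 : x ∈ interior (⋂ n, N n) :=
      interior_maximal h1 (hW.inter hB.1.1.isOpen_compl) ⟨hxW, disjoint_left.1 hPB hx⟩
    rw [hint] at h2
    exact h2
  obtain ⟨z, hzP, hzU, hzV⟩ := isPreconnected_closed_iff.1 hPpre _ _ isClosed_closure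
    isClosed_closure hPUV
    (hclos hUo hVo hUVd hcov hoU hoV (hUB _ hoU) (hVB _ hoV))
    (hclos hVo hUo hUVd.symm (fun x h h' => (hcov x h h').symm) hoV hoU (hVB _ hoV) (hUB _ hoU))
  have hPz : ∀ x ∈ ⋂ n, N n, x = z := by
    intro x hx
    by_contra hxz
    obtain ⟨b, hb⟩ := hB.1.2.nonempty
    obtain ⟨K, hK, hxK, hbK, hKz⟩ :=
      H1.joinedOff_of_interior hB.1 hB.2 (disjoint_left.1 hPB hzP) hb hxz
    have hzK : z ∉ K := disjoint_singleton_right.1 hKz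
    rcases hdich K hK ⟨x, hx, hxK⟩ ⟨b, hb, hbK⟩ with h | h
    · exact hzK (closure_minimal h hK.1 hzU)
    · exact hzK (closure_minimal h hK.1 hzV)
  obtain ⟨n, hn⟩ := exists_subset_nhds_of_isCompact' (V := N) hanti.directed_ge
    (fun n => (hN n).1.1.isCompact) (fun n => (hN n).1.1) (U := O) (fun x hx => hO.mem_nhds (by
      rw [hPz x hx, ← hPz p hpP]
      exact hpO))
  exact ⟨N n, (hN n).1, (hN n).2.1, hn⟩

theorem exists_continuum_nhd_subset [Nontrivial X] (H1 : PointsNonblocking X)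
    (H2 : PairsBlocking X) {p : X} {O : Set X} (hO : IsOpen O) (hpO : p ∈ O) :
    ∃ N, IsContinuum N ∧ p ∈ interior N ∧ N ⊆ O := by
  have hJ := not_fatContinuaMeet H1 H2
  unfold FatContinuaMeet at hJ
  push Not at hJ
  obtain ⟨A, B, hA, hB, ⟨a, ha⟩, hBi, hAB⟩ := hJ
  have hAB : Disjoint A B := disjoint_iff_inter_eq_empty.2 hAB
  by_cases hpa : p = a
  · exact hA.exists_continuum_nhd_subset H1 H2 (hpa ▸ ha) ⟨hB, hBi⟩ hAB hO hpO
  · obtain ⟨N, hN, haN, hNp⟩ := hA.exists_continuum_nhd_subset H1 H2 ha ⟨hB, hBi⟩ hAB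
      (isOpen_compl_singleton (x := p)) (Ne.symm hpa)
    have hpN : p ∈ Nᶜ := fun h => hNp h rfl
    have hN' := hN.closure_compl H1 H2 ((ne_univ_iff_exists_notMem _).2 ⟨p, hpN⟩)
    have haN' : a ∈ (closure Nᶜ)ᶜ := by rwa [closure_compl, compl_compl]
    obtain ⟨M, hM, haM, hMN⟩ := hA.exists_continuum_nhd_subset H1 H2 ha ⟨hB, hBi⟩ hAB
      isClosed_closure.isOpen_compl haN'
    exact hN'.exists_continuum_nhd_subset H1 H2
      (interior_maximal subset_closure hN.1.isOpen_compl hpN) ⟨hM, a, haM⟩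
      (disjoint_right.2 hMN) hO hpO

theorem not_isPreconnected_compl_pair (H1 : PointsNonblocking X)
    (H2 : PairsBlocking X) {p q : X} (hpq : p ≠ q) : ¬ IsPreconnected ({p, q} : Set X)ᶜ := by
  intro hpre
  have : Nontrivial X := ⟨p, q, hpq⟩
  obtain ⟨z, hz, -⟩ := H2 p q hpq
  have hO : IsOpen (({p, q} : Set X)ᶜ) := (toFinite ({p, q} : Set X)).isClosed.isOpen_compl
  have hnhd : ∀ w ∈ ({p, q} : Set X)ᶜ, ∃ N : Set X, w ∈ interior N ∧
      ∀ y ∈ N, JoinedOff {p, q} w y := by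
    intro w hw
    obtain ⟨N, hN, hwN, hNO⟩ := exists_continuum_nhd_subset H1 H2 hO hw
    exact ⟨N, hwN, fun y hy => ⟨N, hN, interior_subset hwN, hy, disjoint_left.2 hNO⟩⟩
  have hG : IsOpen {w | JoinedOff {p, q} w z} := by
    rw [isOpen_iff_mem_nhds]
    intro w hw
    obtain ⟨N, hwN, hN⟩ := hnhd w hw.notMem_left
    exact mem_of_superset (mem_interior_iff_mem_nhds.1 hwN) fun y hy => (hN y hy).symm.trans hw
  have hG' : IsOpen {w | w ∈ ({p, q} : Set X)ᶜ ∧ ¬ JoinedOff {p, q} w z} := by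
    rw [isOpen_iff_mem_nhds]
    rintro w ⟨hw, hwz⟩
    obtain ⟨N, hwN, hN⟩ := hnhd w hw
    exact mem_of_superset (mem_interior_iff_mem_nhds.1 hwN) fun y hy =>
      ⟨(hN y hy).symm.notMem_left, fun h => hwz ((hN y hy).trans h)⟩
  have hd : Disjoint {w | JoinedOff {p, q} w z}
      {w | w ∈ ({p, q} : Set X)ᶜ ∧ ¬ JoinedOff {p, q} w z} :=
    disjoint_left.2 fun w h h' => h'.2 h
  have hzz : JoinedOff {p, q} z z :=
    ⟨{z}, isContinuum_singleton z, rfl, rfl, disjoint_singleton_left.2 hz⟩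
  rcases hpre.subset_or_subset_of_disjoint hG hG' hd fun w hw => by
    by_cases h : JoinedOff {p, q} w z
    · exact Or.inl h
    · exact Or.inr ⟨hw, h⟩ with h | h
  · exact H2.not_forall_joinedOff hpq fun w hwp hwq => h (by simp [hwp, hwq])
  · exact (h hz).2 hzz

end MetricContinua

section Arc

variable {Y : Type*} [TopologicalSpace Y] {p q : Y} {U V : Y → Set Y}

/-- Every point `x` other than `p` and `q` cuts the space into the open sets `U x ∋ p`
and `V x ∋ q`. -/
def IsCutSystem (p q : Y) (U V : Y → Set Y) : Prop :=
  ∀ x, x ≠ p → x ≠ q → IsOpen (U x) ∧ IsOpen (V x) ∧ Disjoint (U x) (V x) ∧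
    U x ∪ V x = {x}ᶜ ∧ p ∈ U x ∧ q ∈ V x

namespace IsCutSystem

theorem symm (h : IsCutSystem p q U V) : IsCutSystem q p V U := fun x hq hp => by
  obtain ⟨h1, h2, h3, h4, h5, h6⟩ := h x hp hq
  exact ⟨h2, h1, h3.symm, by rw [union_comm, h4], h6, h5⟩

theorem self_notMem (h : IsCutSystem p q U V) {x : Y} (hp : x ≠ p) (hq : x ≠ q) : x ∉ U x := by
  obtain ⟨-, -, -, h4, -⟩ := h x hp hq
  exact fun hx => (h4 ▸ Or.inl hx : x ∈ ({x} : Set Y)ᶜ) rfl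

theorem mem_or_mem (h : IsCutSystem p q U V) {x y : Y} (hp : x ≠ p) (hq : x ≠ q) (hyx : y ≠ x) :
    y ∈ U x ∨ y ∈ V x := by
  obtain ⟨-, -, -, h4, -⟩ := h x hp hq
  exact (h4.symm ▸ hyx : y ∈ U x ∪ V x)

variable [ConnectedSpace Y]

theorem insert_subset (h : IsCutSystem p q U V) {x y : Y} (hxp : x ≠ p) (hxq : x ≠ q)
    (hyp : y ≠ p) (hyq : y ≠ q) (hxy : x ∈ U y) : insert y (V y) ⊆ V x := by
  obtain ⟨hU, hV, hUV, hun, -, hq⟩ := h y hyp hyq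
  obtain ⟨hU', hV', hUV', hun', -, hq'⟩ := h x hxp hxq
  have h1 : IsPreconnected ({y} ∪ V y) := isPreconnected_univ.union_of_diff_eq (subset_univ _)
    isPreconnected_singleton (singleton_nonempty y) hV hU hUV.symm
    (by rw [union_comm, hun, compl_eq_univ_sdiff])
  have hxV : x ∉ {y} ∪ V y := by
    rintro (hx | hx)
    · rw [mem_singleton_iff] at hx
      exact h.self_notMem hyp hyq (hx ▸ hxy)
    · exact disjoint_left.1 hUV hxy hx
  rw [← singleton_union]
  rcases h1.subset_or_subset_of_disjoint hU' hV' hUV' fun z hz =>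
    hun'.ge fun hzx => hxV (hzx ▸ hz) with h2 | h2
  · exact absurd (h2 (Or.inr hq)) (disjoint_right.1 hUV' hq')
  · exact h2

theorem inter_nonempty (h : IsCutSystem p q U V) {x y : Y} (hxp : x ≠ p) (hxq : x ≠ q)
    (hyp : y ≠ p) (hyq : y ≠ q) (hxy : x ∈ U y) : (V x ∩ U y).Nonempty := by
  obtain ⟨hU, hV, hUV, hun, hp, hq⟩ := h y hyp hyq
  obtain ⟨hU', hV', hUV', hun', hp', hq'⟩ := h x hxp hxq
  by_contra hne
  refine not_isPreconnected_of_disjoint hU hV' (disjoint_left.2 fun z hz hz' => hne ⟨z, hz', hz⟩)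
    (fun z _ => ?_) ⟨p, mem_univ _, hp⟩ ⟨q, mem_univ _, hq'⟩ isPreconnected_univ
  by_cases hzy : z = y
  · exact Or.inr (h.insert_subset hxp hxq hyp hyq hxy (by rw [hzy]; exact mem_insert y _))
  · exact (h.mem_or_mem hyp hyq hzy).imp_right fun hz =>
      h.insert_subset hxp hxq hyp hyq hxy (mem_insert_of_mem y hz)

theorem diff_singleton_nonempty [T1Space Y] (h : IsCutSystem p q U V) {x : Y} (hxp : x ≠ p)
    (hxq : x ≠ q) : (U x \ {p}).Nonempty := by
  have : Nontrivial Y := ⟨x, p, hxp⟩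
  obtain ⟨hU, hV, hUV, hun, hp, hq⟩ := h x hxp hxq
  obtain ⟨z, hz, hzU⟩ := (dense_compl_singleton p).exists_mem_open hU ⟨p, hp⟩
  exact ⟨z, hzU, hz⟩

/-- A separable connected space in which every point separates `p` from `q` injects
continuously into `[0, 1]`. -/
theorem exists_continuous_injective [T1Space Y] [TopologicalSpace.SeparableSpace Y]
    (h : IsCutSystem p q U V) (hpq : p ≠ q) :
    ∃ f : Y → ℝ, Continuous f ∧ Function.Injective f ∧ f p = 0 ∧ f q = 1 ∧
      ∀ x, 0 ≤ f x ∧ f x ≤ 1 := by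
  classical
  have : Nontrivial Y := ⟨p, q, hpq⟩
  obtain ⟨D₀, hD₀c, hD₀d⟩ := TopologicalSpace.exists_countable_dense Y
  set S : Set Y := {x | x ∈ D₀ ∧ x ≠ p ∧ x ≠ q} with hS
  have hSc : Countable S := (hD₀c.mono fun x hx => hx.1).to_subtype
  have hdense : ∀ O : Set Y, IsOpen O → (O \ {p, q}).Nonempty → ∃ d : S, (d : Y) ∈ O := by
    intro O hO hne
    obtain ⟨z, hz, hzO⟩ := hD₀d.exists_mem_open
      (hO.sdiff (toFinite ({p, q} : Set Y)).isClosed) hne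
    exact ⟨⟨z, hz, fun h => hzO.2 (by simp [h]), fun h => hzO.2 (by simp [h])⟩, hzO.1⟩
  have hbelow : ∀ x, x ≠ p → ∃ d : S, x ∈ V d := by
    intro x hxp
    by_cases hxq : x = q
    · obtain ⟨z, hz, -⟩ := (dense_univ.sdiff_finite (toFinite ({p, q} : Set Y))).exists_mem_open
        isOpen_univ ⟨p, mem_univ _⟩
      obtain ⟨d, -⟩ := hdense univ isOpen_univ ⟨z, hz⟩
      exact ⟨d, hxq ▸ (h d d.2.2.1 d.2.2.2).2.2.2.2.2⟩
    · obtain ⟨z, hz, hzp⟩ := h.diff_singleton_nonempty hxp hxq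
      obtain ⟨hU, hV, hUV, hun, hp, hq⟩ := h x hxp hxq
      obtain ⟨d, hd⟩ := hdense (U x) hU ⟨z, hz, by
        rintro (h1 | h1)
        · exact hzp h1
        · exact disjoint_left.1 hUV hz (h1.symm ▸ hq)⟩
      exact ⟨d, h.insert_subset d.2.2.1 d.2.2.2 hxp hxq hd (mem_insert _ _)⟩
  have habove : ∀ x, x ≠ q → ∃ d : S, x ∈ U d := by
    intro x hxq
    by_cases hxp : x = p
    · obtain ⟨d, -⟩ := hbelow q hpq.symm
      exact ⟨d, hxp ▸ (h d d.2.2.1 d.2.2.2).2.2.2.2.1⟩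
    · obtain ⟨z, hz, hzq⟩ := h.symm.diff_singleton_nonempty hxq hxp
      obtain ⟨hU, hV, hUV, hun, hp, hq⟩ := h x hxp hxq
      obtain ⟨d, hd⟩ := hdense (V x) hV ⟨z, hz, by
        rintro (h1 | h1)
        · exact disjoint_left.1 hUV hp (h1 ▸ hz)
        · exact hzq h1⟩
      exact ⟨d, h.symm.insert_subset d.2.2.2 d.2.2.1 hxq hxp hd (mem_insert _ _)⟩
  have hmid : ∀ x y, x ≠ p → x ≠ q → y ≠ p → y ≠ q → x ∈ U y → ∃ d : S, (d : Y) ∈ V x ∩ U y := by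
    intro x y hxp hxq hyp hyq hxy
    obtain ⟨z, hzx, hzy⟩ := h.inter_nonempty hxp hxq hyp hyq hxy
    refine hdense _ ((h x hxp hxq).2.1.inter (h y hyp hyq).1) ⟨z, ⟨hzx, hzy⟩, ?_⟩
    rintro (h1 | h1)
    · exact disjoint_left.1 (h x hxp hxq).2.2.1 (h x hxp hxq).2.2.2.2.1 (h1 ▸ hzx)
    · exact disjoint_left.1 (h y hyp hyq).2.2.1 hzy (h1.symm ▸ (h y hyp hyq).2.2.2.2.2)
  have hST : IsStrictTotalOrder S fun a b => (a : Y) ∈ U b :=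
    { trichotomous := fun a b hab hba => by
        by_contra hne
        rcases h.mem_or_mem b.2.2.1 b.2.2.2 (fun hab => hne (Subtype.ext hab)) with hx | hx
        · exact hab hx
        · exact hba (h.symm.insert_subset a.2.2.2 a.2.2.1 b.2.2.2 b.2.2.1 hx (mem_insert _ _))
      irrefl := fun a => h.self_notMem a.2.2.1 a.2.2.2
      trans := fun a b c hab hbc =>
        h.symm.insert_subset c.2.2.2 c.2.2.1 b.2.2.2 b.2.2.1
          (h.insert_subset b.2.2.1 b.2.2.2 c.2.2.1 c.2.2.2 hbc (mem_insert _ _))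
          (mem_insert_of_mem _ hab) }
  let _ : LinearOrder S := linearOrderOfSTO fun a b => (a : Y) ∈ U b
  have hlt : ∀ a b : S, a < b ↔ (a : Y) ∈ U b := fun a b => Iff.rfl
  have hlt' : ∀ a b : S, a < b → (b : Y) ∈ V a := fun a b hab =>
    h.insert_subset a.2.2.1 a.2.2.2 b.2.2.1 b.2.2.2 hab (mem_insert _ _)
  have hgt : ∀ a b : S, (b : Y) ∈ V a → a < b := fun a b hab =>
    h.symm.insert_subset b.2.2.2 b.2.2.1 a.2.2.2 a.2.2.1 hab (mem_insert _ _)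
  have i1 : DenselyOrdered S := ⟨fun a b hab => by
    obtain ⟨d, hd1, hd2⟩ := hmid a b a.2.2.1 a.2.2.2 b.2.2.1 b.2.2.2 hab
    exact ⟨d, hgt a d hd1, hd2⟩⟩
  have i2 : NoMinOrder S := ⟨fun a => by
    obtain ⟨d, hd⟩ := hbelow a a.2.2.1
    exact ⟨d, hgt d a hd⟩⟩
  have i3 : NoMaxOrder S := ⟨fun a => habove a a.2.2.2⟩
  have i4 : Nonempty S := ⟨(hbelow q hpq.symm).choose⟩
  have i5 : Nonempty (Ioo (0 : ℚ) 1) := ⟨⟨1 / 2, by norm_num⟩⟩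
  obtain ⟨φ⟩ := Order.iso_of_countable_dense S (Ioo (0 : ℚ) 1)
  set T : Y → Set ℝ := fun x => insert 0 {t | ∃ d : S, x ∈ V d ∧ t = ((φ d : ℚ) : ℝ)} with hT
  have hφ0 : ∀ d, (0 : ℝ) < ((φ d : ℚ) : ℝ) := fun d => by exact_mod_cast (φ d).2.1
  have hφ1 : ∀ d, ((φ d : ℚ) : ℝ) < 1 := fun d => by exact_mod_cast (φ d).2.2
  have hφlt : ∀ a b, a < b → ((φ a : ℚ) : ℝ) < ((φ b : ℚ) : ℝ) := fun a b hab => by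
    exact_mod_cast φ.lt_iff_lt.2 hab
  have hTb : ∀ x, ∀ t ∈ T x, t ≤ 1 := by
    rintro x t (rfl | ⟨d, -, rfl⟩)
    · exact zero_le_one
    · exact (hφ1 d).le
  have hTbdd : ∀ x, BddAbove (T x) := fun x => ⟨1, hTb x⟩
  have hTne : ∀ x, (T x).Nonempty := fun x => ⟨0, mem_insert _ _⟩
  set f : Y → ℝ := fun x => sSup (T x) with hf
  have hf0 : ∀ x, 0 ≤ f x := fun x => le_csSup (hTbdd x) (mem_insert _ _)
  have hf1 : ∀ x, f x ≤ 1 := fun x => csSup_le (hTne x) (hTb x)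
  have hle : ∀ (x : Y) (d : S), x ∈ V d → ((φ d : ℚ) : ℝ) ≤ f x := fun x d hx =>
    le_csSup (hTbdd x) (Or.inr ⟨d, hx, rfl⟩)
  have hge : ∀ (x : Y) (d : S), x ∈ U d → f x ≤ ((φ d : ℚ) : ℝ) := by
    intro x d hx
    refine csSup_le (hTne x) ?_
    rintro t (rfl | ⟨e, he, rfl⟩)
    · exact (hφ0 d).le
    · by_contra! hlt
      have hde : d < e := φ.lt_iff_lt.1 (by exact_mod_cast hlt)
      have hxe : x ∈ U e := h.symm.insert_subset e.2.2.2 e.2.2.1 d.2.2.2 d.2.2.1 (hlt' d e hde)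
        (mem_insert_of_mem _ hx)
      exact disjoint_left.1 (h e e.2.2.1 e.2.2.2).2.2.1 hxe he
  have hVlt : ∀ (x : Y) (d : S), x ∈ V d → ((φ d : ℚ) : ℝ) < f x := by
    intro x d hx
    by_cases hxq : x = q
    · obtain ⟨e, he⟩ := exists_gt d
      exact (hφlt d e he).trans_le (hle x e (hxq ▸ (h e e.2.2.1 e.2.2.2).2.2.2.2.2))
    · have hxp : x ≠ p := by
        rintro rfl
        exact disjoint_left.1 (h d d.2.2.1 d.2.2.2).2.2.1 (h d d.2.2.1 d.2.2.2).2.2.2.2.1 hx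
      obtain ⟨e, he1, he2⟩ := hmid d x d.2.2.1 d.2.2.2 hxp hxq
        (h.symm.insert_subset hxq hxp d.2.2.2 d.2.2.1 hx (mem_insert _ _))
      exact (hφlt d e (hgt d e he1)).trans_le (hle x e
        (h.insert_subset e.2.2.1 e.2.2.2 hxp hxq he2 (mem_insert _ _)))
  have hUlt : ∀ (x : Y) (d : S), x ∈ U d → f x < ((φ d : ℚ) : ℝ) := by
    intro x d hx
    by_cases hxp : x = p
    · obtain ⟨e, he⟩ := exists_lt d
      exact (hge x e (hxp ▸ (h e e.2.2.1 e.2.2.2).2.2.2.2.1)).trans_lt (hφlt e d he)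
    · have hxq : x ≠ q := by
        rintro rfl
        exact disjoint_left.1 (h d d.2.2.1 d.2.2.2).2.2.1 hx (h d d.2.2.1 d.2.2.2).2.2.2.2.2
      obtain ⟨e, he1, he2⟩ := hmid x d hxp hxq d.2.2.1 d.2.2.2 hx
      exact (hge x e (h.symm.insert_subset e.2.2.2 e.2.2.1 hxq hxp he1 (mem_insert _ _))).trans_lt
        (hφlt e d he2)
  have hrat : ∀ r : ℚ, 0 < r → r < 1 → ∃ d, φ d = r := fun r h0 h1 =>
    ⟨φ.symm ⟨r, h0, h1⟩, by simp⟩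
  refine ⟨f, ?_, ?_, ?_, ?_, fun x => ⟨hf0 x, hf1 x⟩⟩
  · rw [OrderTopology.continuous_iff]
    refine fun a => ⟨isOpen_iff_mem_nhds.2 fun x hx => ?_, isOpen_iff_mem_nhds.2 fun x hx => ?_⟩
    · obtain ⟨t, ht, hat⟩ := exists_lt_of_lt_csSup (hTne x) hx
      rcases ht with rfl | ⟨d, hd, rfl⟩
      · exact univ_mem' fun y => hat.trans_le (hf0 y)
      · exact mem_of_superset ((h d d.2.2.1 d.2.2.2).2.1.mem_nhds hd) fun y hy =>
          hat.trans (hVlt y d hy)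
    · have hx' : f x < a := hx
      obtain ⟨r', hr', hra'⟩ := exists_rat_btwn hx'
      obtain ⟨r, hr, hra⟩ := exists_rat_btwn hra'
      by_cases hr1 : (1 : ℝ) ≤ r
      · exact univ_mem' fun y => (hf1 y).trans_lt (hr1.trans_lt hra)
      · have hrr : r' < r := by exact_mod_cast hr
        have h1r : r < 1 := by exact_mod_cast not_le.1 hr1
        have h0r : 0 < r' := by exact_mod_cast (hf0 x).trans_lt hr'
        obtain ⟨d, hd⟩ := hrat r (h0r.trans hrr) h1r
        obtain ⟨e, he⟩ := hrat r' h0r (hrr.trans h1r)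
        have hed : e < d := φ.lt_iff_lt.1 (by rw [← Subtype.coe_lt_coe, hd, he]; exact hrr)
        have hxd : x ∈ U d := by
          have hxV : x ∉ V d := fun hxd => by
            have := hVlt x d hxd
            rw [hd] at this
            linarith
          refine (h.mem_or_mem d.2.2.1 d.2.2.2 ?_).resolve_right hxV
          rintro rfl
          have := hVlt d e (hlt' e d hed)
          rw [he] at this
          linarith
        exact mem_of_superset ((h d d.2.2.1 d.2.2.2).1.mem_nhds hxd) fun y hy => by
          have := hUlt y d hy
          rw [hd] at this
          exact this.trans hra
  · intro x y hxy
    by_contra hne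
    have key : ∀ x y, f x = f y → ∀ d : S, x ∈ V d → y ∈ U d → False := fun x y hxy d hx hy =>
      ((hVlt x d hx).trans_eq hxy).not_gt (hUlt y d hy)
    have hpU : ∀ d : S, p ∈ U d := fun d => (h d d.2.2.1 d.2.2.2).2.2.2.2.1
    have hqV : ∀ d : S, q ∈ V d := fun d => (h d d.2.2.1 d.2.2.2).2.2.2.2.2
    have key2 : ∀ x y, f x = f y → x ≠ p → x ≠ q → y ≠ p → y ≠ q → x ∈ U y → False := by
      intro x y hxy hxp hxq hyp hyq hx
      obtain ⟨d, hd1, hd2⟩ := hmid x y hxp hxq hyp hyq hx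
      exact key y x hxy.symm d (h.insert_subset d.2.2.1 d.2.2.2 hyp hyq hd2 (mem_insert _ _))
        (h.symm.insert_subset d.2.2.2 d.2.2.1 hxq hxp hd1 (mem_insert _ _))
    by_cases hxp : x = p
    · obtain ⟨d, hd⟩ := hbelow y fun h => hne (hxp.trans h.symm)
      exact key y x hxy.symm d hd (hxp ▸ hpU d)
    by_cases hyp : y = p
    · obtain ⟨d, hd⟩ := hbelow x hxp
      exact key x y hxy d hd (hyp ▸ hpU d)
    by_cases hxq : x = q
    · obtain ⟨d, hd⟩ := habove y fun h => hne (hxq.trans h.symm)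
      exact key x y hxy d (hxq ▸ hqV d) hd
    by_cases hyq : y = q
    · obtain ⟨d, hd⟩ := habove x hxq
      exact key y x hxy.symm d (hyq ▸ hqV d) hd
    rcases h.mem_or_mem hyp hyq hne with hx | hx
    · exact key2 x y hxy hxp hxq hyp hyq hx
    · exact key2 y x hxy.symm hyp hyq hxp hxq
        (h.symm.insert_subset hxq hxp hyq hyp hx (mem_insert _ _))
  · refine le_antisymm (csSup_le (hTne p) ?_) (hf0 p)
    rintro t (rfl | ⟨d, hd, rfl⟩)
    · exact le_rfl
    · exact absurd hd (disjoint_left.1 (h d d.2.2.1 d.2.2.2).2.2.1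
        (h d d.2.2.1 d.2.2.2).2.2.2.2.1)
  · refine le_antisymm (hf1 q) (le_of_forall_lt fun c hc => ?_)
    obtain ⟨r, hr, hr1⟩ := exists_rat_btwn (max_lt hc zero_lt_one)
    have h0r : (0 : ℝ) < r := (le_max_right _ _).trans_lt hr
    obtain ⟨d, hd⟩ := hrat r (by exact_mod_cast h0r) (by exact_mod_cast hr1)
    have := hle q d (h d d.2.2.1 d.2.2.2).2.2.2.2.2
    rw [hd] at this
    exact ((le_max_left _ _).trans_lt hr).trans_le this

end IsCutSystem

end Arc

section Circle

variable {X : Type*} [TopologicalSpace X]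

theorem isPreconnected_insert_of_union_eq (h1 : ∀ p : X, IsPreconnected ({p} : Set X)ᶜ)
    {x y : X} (hxy : x ≠ y) {G H : Set X} (hG : IsOpen G) (hH : IsOpen H) (hd : Disjoint G H)
    (h : G ∪ H = {x, y}ᶜ) : IsPreconnected (insert y G) := by
  rw [← singleton_union]
  refine (h1 x).union_of_diff_eq (by simpa using hxy) isPreconnected_singleton
    (singleton_nonempty y) hG hH hd ?_
  rw [h]
  ext z
  simp

/-- If `{p, q}` separates `O₁` from `O₂`, any separation by a point of `O₁` and a point of `O₂`
has `p` and `q` on different sides. -/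
theorem exists_separation_compl_pair (h1 : ∀ p : X, IsPreconnected ({p} : Set X)ᶜ)
    (h2 : ∀ p q : X, p ≠ q → ¬ IsPreconnected ({p, q} : Set X)ᶜ) [T1Space X]
    {p q : X} {O₁ O₂ : Set X} (hO₁ : IsOpen O₁) (hO₂ : IsOpen O₂) (hd : Disjoint O₁ O₂)
    (h : O₁ ∪ O₂ = {p, q}ᶜ) {x y : X} (hx : x ∈ O₁) (hy : y ∈ O₂) :
    ∃ G H, IsOpen G ∧ IsOpen H ∧ Disjoint G H ∧ G ∪ H = {x, y}ᶜ ∧ p ∈ G ∧ q ∈ H := by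
  have hxy : x ≠ y := fun hxy => disjoint_left.1 hd hx (hxy ▸ hy)
  have hO : IsOpen ({x, y} : Set X)ᶜ := (toFinite _).isClosed.isOpen_compl
  obtain ⟨G, H, hG, hH, hGn, hHn, hGH, hun⟩ := hO.exists_separation (h2 x y hxy)
  have hxpq : x ∈ ({p, q} : Set X)ᶜ := h ▸ Or.inl hx
  have hypq : y ∈ ({p, q} : Set X)ᶜ := h ▸ Or.inr hy
  simp only [mem_compl_iff, mem_insert_iff, mem_singleton_iff, not_or] at hxpq hypq
  have key : ∀ {G H : Set X}, IsOpen G → IsOpen H → Disjoint G H → G ∪ H = {x, y}ᶜ →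
      H.Nonempty → p ∈ G → q ∉ G := by
    rintro G H hG hH hGH hun ⟨z, hz⟩ hp hq
    have hsub : ∀ w, w ∈ ({x, y} : Set X) → insert w H ⊆ O₁ ∪ O₂ := by
      rw [h]
      rintro w hw v (rfl | hv) hvpq
      · rcases hw with rfl | rfl <;> rcases hvpq with rfl | rfl <;> tauto
      · rcases hvpq with rfl | rfl
        · exact disjoint_left.1 hGH hp hv
        · exact disjoint_left.1 hGH hq hv
    have hpx : IsPreconnected (insert y H) := isPreconnected_insert_of_union_eq h1 hxy hH hG
      hGH.symm (by rw [union_comm, hun])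
    have hpy : IsPreconnected (insert x H) := isPreconnected_insert_of_union_eq h1 hxy.symm hH hG
      hGH.symm (by rw [union_comm, hun, pair_comm])
    have hx1 : insert x H ⊆ O₁ :=
      (hpy.subset_or_subset_of_disjoint hO₁ hO₂ hd (hsub x (by simp))).resolve_right
        fun hs => disjoint_left.1 hd hx (hs (mem_insert _ _))
    have hy2 : insert y H ⊆ O₂ :=
      (hpx.subset_or_subset_of_disjoint hO₁ hO₂ hd (hsub y (by simp))).resolve_left
        fun hs => disjoint_right.1 hd hy (hs (mem_insert _ _))
    exact disjoint_left.1 hd (hx1 (mem_insert_of_mem _ hz)) (hy2 (mem_insert_of_mem _ hz))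
  have hpm : p ∈ G ∪ H := by
    rw [hun]
    simp [Ne.symm hxpq.1, Ne.symm hypq.1]
  have hqm : q ∈ G ∪ H := by
    rw [hun]
    simp [Ne.symm hxpq.2, Ne.symm hypq.2]
  rcases hpm with hp | hp
  · exact ⟨G, H, hG, hH, hGH, hun, hp, hqm.resolve_left (key hG hH hGH hun hHn hp)⟩
  · have hun' : H ∪ G = {x, y}ᶜ := by rw [union_comm, hun]
    exact ⟨H, G, hH, hG, hGH.symm, hun', hp,
      hqm.resolve_right (key hH hG hGH.symm hun' hGn hp)⟩

theorem exists_arc_of_separation [T1Space X] [SecondCountableTopology X]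
    (h1 : ∀ p : X, IsPreconnected ({p} : Set X)ᶜ)
    (h2 : ∀ p q : X, p ≠ q → ¬ IsPreconnected ({p, q} : Set X)ᶜ)
    {p q : X} (hpq : p ≠ q) {O₁ O₂ : Set X} (hO₁ : IsOpen O₁) (hO₂ : IsOpen O₂)
    (hd : Disjoint O₁ O₂) (h : O₁ ∪ O₂ = {p, q}ᶜ) (hO₁n : O₁.Nonempty) (hO₂n : O₂.Nonempty) :
    ∃ f : X → ℝ, ContinuousOn f O₂ᶜ ∧ InjOn f O₂ᶜ ∧ f p = 0 ∧ f q = 1 ∧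
      (∀ x ∈ O₂ᶜ, f x ∈ Icc (0 : ℝ) 1) ∧ SurjOn f O₂ᶜ (Icc 0 1) := by
  classical
  have hp2 : p ∈ O₂ᶜ := fun hp => (h ▸ Or.inr hp : p ∈ ({p, q} : Set X)ᶜ) (by simp)
  have hq2 : q ∈ O₂ᶜ := fun hp => (h ▸ Or.inr hp : q ∈ ({p, q} : Set X)ᶜ) (by simp)
  obtain ⟨w, hw⟩ := hO₁n
  obtain ⟨y, hy⟩ := hO₂n
  have hOeq : O₂ᶜ = insert p O₁ ∪ insert q O₁ := by
    ext z
    have hz : z ∈ O₁ ∪ O₂ ↔ z ∈ ({p, q} : Set X)ᶜ := by rw [h]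
    by_cases hz1 : z ∈ O₁
    · simp [hz1, disjoint_left.1 hd hz1]
    · simp only [mem_union, hz1, false_or, mem_compl_iff, mem_insert_iff, mem_singleton_iff] at hz
      simp only [mem_compl_iff, hz, mem_union, mem_insert_iff, hz1]
      tauto
  have hconn : IsConnected O₂ᶜ := by
    refine ⟨⟨p, hp2⟩, ?_⟩
    rw [hOeq]
    exact IsPreconnected.union w (mem_insert_of_mem _ hw) (mem_insert_of_mem _ hw)
      (isPreconnected_insert_of_union_eq h1 hpq.symm hO₁ hO₂ hd (by rw [h, pair_comm]))
      (isPreconnected_insert_of_union_eq h1 hpq hO₁ hO₂ hd h)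
  have : ConnectedSpace (O₂ᶜ : Set X) := Subtype.connectedSpace hconn
  have hsep : ∀ x : (O₂ᶜ : Set X), ∃ G H : Set X, x ≠ ⟨p, hp2⟩ → x ≠ ⟨q, hq2⟩ →
      IsOpen G ∧ IsOpen H ∧ Disjoint G H ∧ G ∪ H = {(x : X), y}ᶜ ∧ p ∈ G ∧ q ∈ H := by
    intro x
    by_cases hx : (x : X) ∈ O₁
    · obtain ⟨G, H, hGH⟩ := exists_separation_compl_pair h1 h2 hO₁ hO₂ hd h hx hy
      exact ⟨G, H, fun _ _ => hGH⟩
    · refine ⟨∅, ∅, fun hxp hxq => absurd ?_ x.2⟩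
      refine (h.ge ?_ : (x : X) ∈ O₁ ∪ O₂).resolve_left hx
      rintro (hx' | hx')
      · exact hxp (Subtype.ext hx')
      · exact hxq (Subtype.ext hx')
  choose G H hGH using hsep
  have hcut : IsCutSystem (⟨p, hp2⟩ : (O₂ᶜ : Set X)) ⟨q, hq2⟩
      (fun x => Subtype.val ⁻¹' G x) (fun x => Subtype.val ⁻¹' H x) := by
    intro x hxp hxq
    obtain ⟨h1, h2, h3, h4, h5, h6⟩ := hGH x hxp hxq
    refine ⟨h1.preimage continuous_subtype_val, h2.preimage continuous_subtype_val,
      h3.preimage _, ?_, h5, h6⟩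
    rw [← preimage_union, h4]
    ext z
    have : (z : X) ≠ y := fun hz => z.2 (hz ▸ hy)
    simp [this, Subtype.ext_iff]
  obtain ⟨f, hf, hfi, hfp, hfq, hfI⟩ :=
    hcut.exists_continuous_injective fun hh => hpq (congrArg Subtype.val hh)
  set g : X → ℝ := fun x => if hx : x ∈ O₂ᶜ then f ⟨x, hx⟩ else 0 with hg
  have hgf : ∀ x (hx : x ∈ O₂ᶜ), g x = f ⟨x, hx⟩ := fun x hx => dif_pos hx
  have hgc : ContinuousOn g O₂ᶜ := by
    rw [continuousOn_iff_continuous_domRestrict]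
    convert hf using 1
    ext x
    exact hgf x x.2
  have hgp : g p = 0 := (hgf p hp2).trans hfp
  have hgq : g q = 1 := (hgf q hq2).trans hfq
  refine ⟨g, hgc, fun a ha b hb hab => ?_, hgp, hgq, fun x hx => ?_, ?_⟩
  · rw [hgf a ha, hgf b hb] at hab
    exact congrArg Subtype.val (hfi hab)
  · rw [hgf x hx]
    exact hfI _
  · have := hconn.isPreconnected.intermediate_value hp2 hq2 hgc
    rwa [hgp, hgq] at this

theorem nonempty_homeomorph_circle [T2Space X] [CompactSpace X] [SecondCountableTopology X]
    [Nontrivial X] (h1 : ∀ p : X, IsPreconnected ({p} : Set X)ᶜ)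
    (h2 : ∀ p q : X, p ≠ q → ¬ IsPreconnected ({p, q} : Set X)ᶜ) :
    Nonempty (X ≃ₜ {p : ℝ × ℝ // p.1 ^ 2 + p.2 ^ 2 = 1}) := by
  classical
  obtain ⟨p, q, hpq⟩ := exists_pair_ne X
  have hO : IsOpen ({p, q} : Set X)ᶜ := (toFinite _).isClosed.isOpen_compl
  obtain ⟨O₁, O₂, hO₁, hO₂, hn₁, hn₂, hd, hun⟩ := hO.exists_separation (h2 p q hpq)
  obtain ⟨f, hfc, hfi, hfp, hfq, hfI, hfs⟩ :=
    exists_arc_of_separation h1 h2 hpq hO₁ hO₂ hd hun hn₁ hn₂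
  obtain ⟨g, hgc, hgi, hgp, hgq, hgI, hgs⟩ :=
    exists_arc_of_separation h1 h2 hpq hO₂ hO₁ hd.symm (by rw [union_comm, hun]) hn₂ hn₁
  set a : ℝ → ℝ := fun t => √(1 - (1 - 2 * t) ^ 2) with ha
  have hac : Continuous a := by fun_prop
  have ha0 : ∀ t, 0 ≤ a t := fun t => Real.sqrt_nonneg _
  have hasq : ∀ t ∈ Icc (0 : ℝ) 1, a t ^ 2 = 1 - (1 - 2 * t) ^ 2 := fun t ht =>
    Real.sq_sqrt (by nlinarith [ht.1, ht.2])
  set F : X → ℝ × ℝ := fun x => if x ∈ O₂ᶜ then (1 - 2 * f x, a (f x)) else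
    (1 - 2 * g x, -a (g x)) with hF
  have hends : ∀ x, x ∈ O₂ᶜ → x ∈ O₁ᶜ → x = p ∨ x = q := by
    intro x hx2 hx1
    by_contra hx
    exact (hun.ge hx : x ∈ O₁ ∪ O₂).elim hx1 hx2
  have hF1 : ∀ x ∈ O₂ᶜ, F x = (1 - 2 * f x, a (f x)) := fun x hx => if_pos hx
  have hF2 : ∀ x ∈ O₁ᶜ, F x = (1 - 2 * g x, -a (g x)) := by
    intro x hx
    by_cases hx2 : x ∈ O₂ᶜ
    · rw [hF1 x hx2]
      rcases hends x hx2 hx with rfl | rfl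
      · simp [hfp, hgp, ha]
      · simp only [hfq, hgq, ha]
        norm_num
    · exact if_neg hx2
  have hcover : O₂ᶜ ∪ O₁ᶜ = (univ : Set X) := by
    rw [← compl_inter, inter_comm, hd.inter_eq, compl_empty]
  have hmem : ∀ x, x ∈ O₂ᶜ ∨ x ∈ O₁ᶜ := fun x => hcover.ge (mem_univ x)
  have hFc : Continuous F := by
    rw [← continuousOn_univ, ← hcover]
    refine ContinuousOn.union_of_isClosed ?_ ?_ hO₂.isClosed_compl hO₁.isClosed_compl
    · refine ContinuousOn.congr ?_ hF1
      exact (continuousOn_const.sub (continuousOn_const.mul hfc)).prodMk (hac.comp_continuousOn hfc)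
    · refine ContinuousOn.congr ?_ hF2
      exact (continuousOn_const.sub (continuousOn_const.mul hgc)).prodMk
        (hac.comp_continuousOn hgc).neg
  have hFS : ∀ x, (F x).1 ^ 2 + (F x).2 ^ 2 = 1 := by
    intro x
    rcases hmem x with hx | hx
    · rw [hF1 x hx]
      linarith [hasq _ (hfI x hx)]
    · rw [hF2 x hx]
      linarith [hasq _ (hgI x hx)]
  have hcross : ∀ x ∈ O₂ᶜ, ∀ y ∈ O₁ᶜ, F x = F y → x = y := by
    intro x hx y hy hxy
    have hxy' := hxy
    rw [hF1 x hx, hF2 y hy, Prod.mk.injEq] at hxy'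
    have hz : a (f x) = 0 := by linarith [ha0 (f x), ha0 (g y), hxy'.2]
    have hsq := hasq _ (hfI x hx)
    rw [hz] at hsq
    have h01 : f x = 0 ∨ f x = 1 := by
      have : f x * (f x - 1) = 0 := by linarith
      rcases mul_eq_zero.1 this with h | h
      · exact Or.inl h
      · exact Or.inr (by linarith)
    have hp2 : p ∈ O₂ᶜ := fun hp => (hun ▸ Or.inr hp : p ∈ ({p, q} : Set X)ᶜ) (by simp)
    have hq2 : q ∈ O₂ᶜ := fun hp => (hun ▸ Or.inr hp : q ∈ ({p, q} : Set X)ᶜ) (by simp)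
    have hp1 : p ∈ O₁ᶜ := fun hp => (hun ▸ Or.inl hp : p ∈ ({p, q} : Set X)ᶜ) (by simp)
    have hq1 : q ∈ O₁ᶜ := fun hp => (hun ▸ Or.inl hp : q ∈ ({p, q} : Set X)ᶜ) (by simp)
    rcases h01 with h | h
    · exact (hfi hx hp2 (h.trans hfp.symm)).trans
        (hgi hy hp1 (by rw [hgp]; linarith [hxy'.1])).symm
    · exact (hfi hx hq2 (h.trans hfq.symm)).trans
        (hgi hy hq1 (by rw [hgq]; linarith [hxy'.1])).symm
  have hFi : Function.Injective F := by
    intro x y hxy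
    rcases hmem x with hx | hx <;> rcases hmem y with hy | hy
    · have := congrArg Prod.fst hxy
      rw [hF1 x hx, hF1 y hy] at this
      exact hfi hx hy (by linarith)
    · exact hcross x hx y hy hxy
    · exact (hcross y hy x hx hxy.symm).symm
    · have := congrArg Prod.fst hxy
      rw [hF2 x hx, hF2 y hy] at this
      exact hgi hx hy (by linarith)
  have hFsurj : ∀ z : ℝ × ℝ, z.1 ^ 2 + z.2 ^ 2 = 1 → ∃ x, F x = z := by
    rintro ⟨u, v⟩ huv
    simp only at huv
    have ht : (1 - u) / 2 ∈ Icc (0 : ℝ) 1 := by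
      constructor <;> nlinarith [sq_nonneg v]
    have hav : a ((1 - u) / 2) = |v| := by
      rw [← Real.sqrt_sq_eq_abs]
      simp only [ha]
      congr 1
      linarith
    rcases le_total 0 v with hv | hv
    · obtain ⟨x, hx, hfx⟩ := hfs ht
      refine ⟨x, ?_⟩
      rw [hF1 x hx, hfx, hav, abs_of_nonneg hv, Prod.mk.injEq]
      exact ⟨by ring, rfl⟩
    · obtain ⟨x, hx, hgx⟩ := hgs ht
      refine ⟨x, ?_⟩
      rw [hF2 x hx, hgx, hav, abs_of_nonpos hv, neg_neg, Prod.mk.injEq]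
      exact ⟨by ring, rfl⟩
  let e : X ≃ {p : ℝ × ℝ // p.1 ^ 2 + p.2 ^ 2 = 1} := Equiv.ofBijective (fun x => ⟨F x, hFS x⟩)
    ⟨fun x y hxy => hFi (congrArg Subtype.val hxy),
      fun z => (hFsurj z z.2).imp fun x hx => Subtype.ext hx⟩
  have he : Continuous e := hFc.subtype_mk hFS
  exact ⟨he.homeoOfEquivCompactToT2⟩

end Circle

section NonBlocking

theorem nontrivial_of_NB_eq_F1 {X : Type*} [TopologicalSpace X] [Nonempty X]
    (h : NB X = F1 X) : Nontrivial X := by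
  obtain ⟨p⟩ := ‹Nonempty X›
  have hp : ({p} : Set X) ∈ NB X := h ▸ ⟨p, rfl⟩
  obtain ⟨x, hx⟩ := (ne_univ_iff_exists_notMem _).1 hp.2.1
  exact ⟨x, p, hx⟩

variable {X : Type*} [TopologicalSpace X] [CompactSpace X] [T2Space X]

theorem pointsNonblocking_of_NB_eq_F1 (h : NB X = F1 X) : PointsNonblocking X := by
  intro p x hx
  have hp : ({p} : Set X) ∈ NB X := h ▸ ⟨p, rfl⟩
  exact notBlocks_iff_dense_joinedOff.1 (hp.2.2.2 x hx)

theorem pairsBlocking_of_NB_eq_F1 [ConnectedSpace X] (h : NB X = F1 X) : PairsBlocking X := by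
  intro p q hpq
  have : Nontrivial X := ⟨p, q, hpq⟩
  by_contra! hx
  have hmem : ({p, q} : Set X) ∈ NB X := by
    refine ⟨insert_nonempty _ _, fun hu => ?_, (toFinite _).isClosed,
      fun x hxpq => notBlocks_iff_dense_joinedOff.2 (hx x hxpq)⟩
    obtain ⟨z, hz, -⟩ := (dense_univ.sdiff_finite (toFinite ({p, q} : Set X))).exists_mem_open
      isOpen_univ ⟨p, mem_univ _⟩
    exact hz.2 (hu ▸ mem_univ z)
  rw [h] at hmem
  obtain ⟨z, hz⟩ := hmem
  exact hpq ((hz.subset (mem_insert p _)).trans (hz.subset (mem_insert_of_mem p rfl)).symm)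

theorem NB_eq_F1_of_joinedOff [ConnectedSpace X] [Nontrivial X]
    (hJ : ∀ p x y : X, x ≠ p → y ≠ p → JoinedOff {p} x y)
    (hS : ∀ p q : X, p ≠ q → ∃ G H : Set X, IsOpen G ∧ IsOpen H ∧ G.Nonempty ∧ H.Nonempty ∧
      Disjoint G H ∧ {p, q}ᶜ ⊆ G ∪ H) : NB X = F1 X := by
  refine Subset.antisymm ?_ ?_
  · rintro B ⟨⟨p, hp⟩, hBu, hBc, hB⟩
    refine ⟨p, eq_singleton_iff_unique_mem.2 ⟨hp, fun q hq => ?_⟩⟩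
    by_contra hqp
    obtain ⟨G, H, hG, hH, hGn, hHn, hGH, hun⟩ := hS p q (Ne.symm hqp)
    obtain ⟨x, hx⟩ := (ne_univ_iff_exists_notMem _).1 hBu
    have hd := notBlocks_iff_dense_joinedOff.1 (hB x hx)
    obtain ⟨a, ⟨K, hK, hxK, haK, hKB⟩, haG⟩ := hd.exists_mem_open hG hGn
    obtain ⟨b, ⟨L, hL, hxL, hbL, hLB⟩, hbH⟩ := hd.exists_mem_open hH hHn
    have hsub : ∀ M : Set X, Disjoint M B → M ⊆ G ∪ H := fun M hM z hz => hun <| by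
      rintro (rfl | rfl)
      · exact disjoint_left.1 hM hz hp
      · exact disjoint_left.1 hM hz hq
    have hKG := (hK.2.isPreconnected.subset_or_subset_of_disjoint hG hH hGH
      (hsub K hKB)).resolve_right fun hs => disjoint_left.1 hGH haG (hs haK)
    have hLH := (hL.2.isPreconnected.subset_or_subset_of_disjoint hG hH hGH
      (hsub L hLB)).resolve_left fun hs => disjoint_right.1 hGH hbH (hs hbL)
    exact disjoint_left.1 hGH (hKG hxK) (hLH hxL)
  · rintro B ⟨p, rfl⟩
    obtain ⟨x, hx⟩ := exists_ne p
    refine ⟨singleton_nonempty p, fun hu => hx (hu.ge (mem_univ x)), isClosed_singleton,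
      fun x hx => notBlocks_iff_dense_joinedOff.2 ?_⟩
    exact (dense_compl_singleton p).mono fun y hy => hJ p x y hx hy

end NonBlocking

section UnitCircle

theorem exists_cos_sin_eq {a b : ℝ} (h : a ^ 2 + b ^ 2 = 1) :
    ∃ t, Real.cos t = a ∧ Real.sin t = b := by
  have hn : ‖(⟨a, b⟩ : ℂ)‖ = 1 := by
    rw [Complex.norm_def, Complex.normSq_mk, Real.sqrt_eq_one]
    linarith
  have hz : (⟨a, b⟩ : ℂ) ≠ 0 := fun h0 => by simp [h0] at hn
  exact ⟨Complex.arg ⟨a, b⟩, by rw [Complex.cos_arg hz, hn, div_one],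
    by rw [Complex.sin_arg, hn, div_one]⟩

theorem circle_joinedOff (p x y : {p : ℝ × ℝ // p.1 ^ 2 + p.2 ^ 2 = 1}) (hx : x ≠ p)
    (hy : y ≠ p) : JoinedOff {p} x y := by
  obtain ⟨θ, hθ1, hθ2⟩ := exists_cos_sin_eq p.2
  let c : ℝ → {p : ℝ × ℝ // p.1 ^ 2 + p.2 ^ 2 = 1} := fun t =>
    ⟨(Real.cos t, Real.sin t), Real.cos_sq_add_sin_sq t⟩
  have hc : Continuous c := by fun_prop
  have hcp : c θ = p := Subtype.ext (Prod.ext hθ1 hθ2)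
  have hsurj : ∀ z, z ≠ p → ∃ t ∈ Ioo θ (θ + 2 * Real.pi), c t = z := by
    intro z hz
    obtain ⟨s, hs1, hs2⟩ := exists_cos_sin_eq z.2
    obtain ⟨n, hn, -⟩ := existsUnique_add_zsmul_mem_Ico Real.two_pi_pos s θ
    have hcs : c (s + n • (2 * Real.pi)) = z := by
      refine Subtype.ext (Prod.ext ?_ ?_)
      · simp only [c, zsmul_eq_mul, Real.cos_add_int_mul_two_pi, hs1]
      · simp only [c, zsmul_eq_mul, Real.sin_add_int_mul_two_pi, hs2]
    refine ⟨_, ⟨lt_of_le_of_ne hn.1 fun he => hz ?_, hn.2⟩, hcs⟩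
    rw [← hcs, ← he, hcp]
  have hne : ∀ t ∈ Ioo θ (θ + 2 * Real.pi), c t ≠ p := by
    intro t ht htp
    have h1 : Real.cos t = Real.cos θ := by
      rw [hθ1, ← htp]
    have h2 : Real.sin t = Real.sin θ := by
      rw [hθ2, ← htp]
    have h3 : Real.cos (t - θ) = 1 := by
      rw [Real.cos_sub, h1, h2]
      linarith [Real.cos_sq_add_sin_sq θ]
    have := (Real.cos_eq_one_iff_of_lt_of_lt (by linarith [ht.1, Real.pi_pos])
      (by linarith [ht.2])).1 h3
    linarith [ht.1]
  obtain ⟨s, hs, rfl⟩ := hsurj x hx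
  obtain ⟨t, ht, rfl⟩ := hsurj y hy
  refine ⟨c '' uIcc s t, ⟨(isCompact_uIcc.image hc).isClosed,
    ⟨nonempty_uIcc.image c, isPreconnected_uIcc.image c hc.continuousOn⟩⟩,
    mem_image_of_mem c left_mem_uIcc, mem_image_of_mem c right_mem_uIcc, ?_⟩
  rw [disjoint_singleton_right]
  rintro ⟨r, hr, hrp⟩
  exact hne r (ordConnected_Ioo.uIcc_subset hs ht hr) hrp

theorem circle_exists_separation (p q : {p : ℝ × ℝ // p.1 ^ 2 + p.2 ^ 2 = 1}) (hpq : p ≠ q) :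
    ∃ G H : Set {p : ℝ × ℝ // p.1 ^ 2 + p.2 ^ 2 = 1}, IsOpen G ∧ IsOpen H ∧ G.Nonempty ∧
      H.Nonempty ∧ Disjoint G H ∧ {p, q}ᶜ ⊆ G ∪ H := by
  obtain ⟨⟨a, b⟩, hab⟩ := p
  obtain ⟨⟨c, d⟩, hcd⟩ := q
  simp only at hab hcd
  set D : {p : ℝ × ℝ // p.1 ^ 2 + p.2 ^ 2 = 1} → ℝ := fun z =>
    (c - a) * (z.1.2 - b) - (d - b) * (z.1.1 - a) with hD
  have hDc : Continuous D := by fun_prop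
  have hr : 0 < (c - a) ^ 2 + (d - b) ^ 2 := by
    by_contra! hr
    have h1 : c - a = 0 := by nlinarith [sq_nonneg (c - a), sq_nonneg (d - b)]
    have h2 : d - b = 0 := by nlinarith [sq_nonneg (c - a), sq_nonneg (d - b)]
    exact hpq (Subtype.ext (Prod.ext (by simp only; linarith) (by simp only; linarith)))
  have hPQ : a * (c - a) + b * (d - b) = -((c - a) ^ 2 + (d - b) ^ 2) / 2 := by linarith
  have hzero : ∀ z, D z = 0 → z = ⟨(a, b), hab⟩ ∨ z = ⟨(c, d), hcd⟩ := by
    rintro ⟨⟨s, t⟩, hst⟩ hz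
    simp only [hD] at hz hst
    set P := c - a with hP
    set Q := d - b with hQ
    set M := P * (s - a) + Q * (t - b) with hM
    have e1 : (P ^ 2 + Q ^ 2) * (s - a) = P * M := by
      rw [hM]; linear_combination -Q * hz
    have e2 : (P ^ 2 + Q ^ 2) * (t - b) = Q * M := by
      rw [hM]; linear_combination P * hz
    have e3 : (s - a) ^ 2 + (t - b) ^ 2 + 2 * a * (s - a) + 2 * b * (t - b) = 0 := by
      linear_combination hst - hab
    have e4 : (P ^ 2 + Q ^ 2) * (M * (M - (P ^ 2 + Q ^ 2))) = 0 := by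
      linear_combination (P ^ 2 + Q ^ 2) ^ 2 * e3 - 2 * (P ^ 2 + Q ^ 2) * M * hPQ
        - ((P ^ 2 + Q ^ 2) * (s - a) + P * M + 2 * a * (P ^ 2 + Q ^ 2)) * e1
        - ((P ^ 2 + Q ^ 2) * (t - b) + Q * M + 2 * b * (P ^ 2 + Q ^ 2)) * e2
    have e5 := (mul_eq_zero.1 e4).resolve_left hr.ne'
    rcases mul_eq_zero.1 e5 with h | h
    · left
      rw [h, mul_zero] at e1 e2
      have h1 := (mul_eq_zero.1 e1).resolve_left hr.ne'
      have h2 := (mul_eq_zero.1 e2).resolve_left hr.ne'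
      exact Subtype.ext (Prod.ext (by simp only; linarith) (by simp only; linarith))
    · right
      rw [sub_eq_zero.1 h, mul_comm] at e1 e2
      have h1 := mul_right_cancel₀ hr.ne' e1
      have h2 := mul_right_cancel₀ hr.ne' e2
      exact Subtype.ext (Prod.ext (by simp only; linarith) (by simp only; linarith))
  set r := √((c - a) ^ 2 + (d - b) ^ 2) with hrdef
  have hr0 : 0 < r := Real.sqrt_pos.2 hr
  have hrsq : r ^ 2 = (c - a) ^ 2 + (d - b) ^ 2 := Real.sq_sqrt hr.le
  have hlt : |c * b - d * a| < r := by
    refine abs_lt_of_sq_lt_sq ?_ hr0.le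
    have hu : 0 < 1 - (a * c + b * d) := by linarith
    have : r ^ 2 - (c * b - d * a) ^ 2 = (1 - (a * c + b * d)) ^ 2 := by
      rw [hrsq]
      linear_combination (1 - c ^ 2 - d ^ 2) * hab
    nlinarith [pow_pos hu 2]
  obtain ⟨hlt1, hlt2⟩ := abs_lt.1 hlt
  have hunit : (-(d - b) / r) ^ 2 + ((c - a) / r) ^ 2 = 1 := by
    field_simp
    linarith
  have hunit' : ((d - b) / r) ^ 2 + (-(c - a) / r) ^ 2 = 1 := by
    field_simp
    linarith
  refine ⟨{z | 0 < D z}, {z | D z < 0}, isOpen_lt continuous_const hDc,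
    isOpen_lt hDc continuous_const, ⟨⟨(-(d - b) / r, (c - a) / r), hunit⟩, ?_⟩,
    ⟨⟨((d - b) / r, -(c - a) / r), hunit'⟩, ?_⟩,
    disjoint_left.2 fun z (hz : 0 < D z) (hz' : D z < 0) => lt_asymm hz hz', fun z hz => ?_⟩
  · have : D ⟨(-(d - b) / r, (c - a) / r), hunit⟩ = r - (c * b - d * a) := by
      simp only [hD]
      field_simp
      linear_combination -hrsq
    rw [mem_ofPred_eq, this]
    linarith
  · have : D ⟨((d - b) / r, -(c - a) / r), hunit'⟩ = -r - (c * b - d * a) := by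
      simp only [hD]
      field_simp
      linear_combination hrsq
    rw [mem_ofPred_eq, this]
    linarith
  · rcases lt_trichotomy (D z) 0 with h | h | h
    · exact Or.inr h
    · exact absurd (hzero z h) hz
    · exact Or.inl h

end UnitCircle

/-- A continuum is homeomorphic to the unit circle iff `NB(F₁(X)) = F₁(X)`. -/
theorem stmt0 (X : Type*) [MetricSpace X] [CompactSpace X] [ConnectedSpace X] [Nonempty X] :
    Nonempty (X ≃ₜ {p : ℝ × ℝ // p.1 ^ 2 + p.2 ^ 2 = 1}) ↔ NB X = F1 X := by
  constructor
  · rintro ⟨e⟩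
    have : Nontrivial {p : ℝ × ℝ // p.1 ^ 2 + p.2 ^ 2 = 1} :=
      ⟨⟨(1, 0), by norm_num⟩, ⟨(-1, 0), by norm_num⟩, fun h => by
        have := congrArg (fun z => z.1.1) h
        norm_num at this⟩
    have : Nontrivial X := e.toEquiv.nontrivial
    refine NB_eq_F1_of_joinedOff (fun p x y hx hy => ?_) fun p q hpq => ?_
    · obtain ⟨K, hK, hxK, hyK, hd⟩ := circle_joinedOff (e p) (e x) (e y) (e.injective.ne hx)
        (e.injective.ne hy)
      refine ⟨e ⁻¹' K, ⟨hK.1.preimage e.continuous, e.isConnected_preimage.2 hK.2⟩, hxK, hyK, ?_⟩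
      rw [disjoint_singleton_right] at hd ⊢
      exact hd
    · obtain ⟨G, H, hG, hH, hGn, hHn, hGH, hun⟩ :=
        circle_exists_separation (e p) (e q) (e.injective.ne hpq)
      refine ⟨e ⁻¹' G, e ⁻¹' H, hG.preimage e.continuous, hH.preimage e.continuous,
        hGn.preimage e.surjective, hHn.preimage e.surjective, hGH.preimage e, fun z hz => ?_⟩
      exact hun fun h => hz (h.imp (fun h => e.injective h) fun h => e.injective h)
  · intro h
    have H1 := pointsNonblocking_of_NB_eq_F1 h
    have H2 := pairsBlocking_of_NB_eq_F1 h
    have := nontrivial_of_NB_eq_F1 h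
    exact nonempty_homeomorph_circle
      (fun p => (isContinuum_singleton p).isPreconnected_compl H1 H2)
      fun p q hpq => not_isPreconnected_compl_pair H1 H2 hpq
end

section
/- Let X be a continuum such that there exists p ∈ X with {p} ∈ S(X) \ NB*(F₁(X)). If X \ L is disconnected for some proper subcontinuum L of X, then NB*(F₁(X)) is an infinite set. -/
open Set Filter Metric

/-- Sets converging to the whole space in the Hausdorff metric eventually meet every
nonempty open set. -/
lemma eventually_inter_nonempty_of_tendsto_hausdorffDist {X : Type*} [MetricSpace X]
    [CompactSpace X] {C : ℕ → Set X} (hne : ∀ n, (C n).Nonempty)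
    (hC : Tendsto (fun n => hausdorffDist (C n) (univ : Set X)) atTop (nhds 0))
    {O : Set X} (hO : IsOpen O) (hOne : O.Nonempty) : ∀ᶠ n in atTop, (C n ∩ O).Nonempty := by
  obtain ⟨y, hy⟩ := hOne
  obtain ⟨ε, hε, hball⟩ := Metric.isOpen_iff.1 hO y hy
  filter_upwards [hC.eventually_lt_const hε] with n hn
  have hfin : hausdorffEDist (C n) (univ : Set X) ≠ ⊤ :=
    hausdorffEDist_ne_top_of_nonempty_of_bounded (hne n) ⟨y, mem_univ y⟩
      (isCompact_univ.isBounded.subset (subset_univ _)) isCompact_univ.isBounded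
  obtain ⟨x, hx, hxy⟩ := exists_dist_lt_of_hausdorffDist_lt' (mem_univ y) hn hfin
  exact ⟨x, hx, hball hxy⟩

/-- If frequently `C n` lies in a subcontinuum that contains `x` and misses `q`, where the
sets `C n` eventually meet every nonempty open set, then `{q}` belongs to `NB*(F₁(X))`. -/
lemma singleton_mem_NBstar_of_frequently {X : Type*} [MetricSpace X] {C : ℕ → Set X}
    (hC : ∀ O : Set X, IsOpen O → O.Nonempty → ∀ᶠ n in atTop, (C n ∩ O).Nonempty)
    {q x : X} (hxq : x ≠ q)
    (h : ∃ᶠ n in atTop, ∃ K : Set X, IsCompact K ∧ IsConnected K ∧ x ∈ K ∧ q ∉ K ∧ C n ⊆ K) :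
    ({q} : Set X) ∈ NBstar X := by
  refine ⟨singleton_nonempty q, fun hu => hxq (hu.symm.subset (mem_univ x)),
    isClosed_singleton, x, hxq, dense_iff_inter_open.2 fun O hO hOne => ?_⟩
  obtain ⟨n, ⟨K, hKc, hKconn, hxK, hqK, hCK⟩, y, hyC, hyO⟩ :=
    (h.and_eventually (hC O hO hOne)).exists
  exact ⟨y, hyO, K, ⟨hKc, hKconn, hxK, subset_compl_singleton_iff.2 hqK⟩, hCK hyC⟩

theorem stmt1 (X : Type*) [MetricSpace X] [CompactSpace X] [ConnectedSpace X] [Nonempty X]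
    (p : X) (hpS : ShoreSet ({p} : Set X)) (hpNB : ({p} : Set X) ∉ NBstar X)
    (L : Set X) (hLc : IsCompact L) (hLconn : IsConnected L) (hLprop : L ≠ univ)
    (hdis : ¬ IsPreconnected Lᶜ) :
    (NBstar X).Infinite := by
  obtain ⟨-, -, -, C, hC, hlim⟩ := hpS
  have hmeet := fun (O : Set X) (hO : IsOpen O) (hOne : O.Nonempty) =>
    eventually_inter_nonempty_of_tendsto_hausdorffDist (fun n => (hC n).2.1.nonempty) hlim hO hOne
  have hpC : ∀ n, p ∉ C n := fun n hp => (hC n).2.2 hp rfl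
  have hLo : IsOpen Lᶜ := hLc.isClosed.isOpen_compl
  have hCL : ∀ᶠ n in atTop, (L ∩ C n).Nonempty := by
    simp only [IsPreconnected, not_forall] at hdis
    obtain ⟨U, V, hU, hV, hUV, hLU, hLV, hdisj⟩ := hdis
    filter_upwards [hmeet _ (hLo.inter hU) hLU, hmeet _ (hLo.inter hV) hLV] with n hnU hnV
    by_contra hn
    have hsub : C n ⊆ Lᶜ := fun x hx hxL => hn ⟨x, hxL, hx⟩
    obtain ⟨x, hx, hxUV⟩ := (hC n).2.1.isPreconnected U V hU hV (hsub.trans hUV)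
      (hnU.mono fun x hx => ⟨hx.1, hx.2.2⟩) (hnV.mono fun x hx => ⟨hx.1, hx.2.2⟩)
    exact hdisj ⟨x, hsub hx, hxUV⟩
  have hunion : ∀ {x q : X}, x ∈ L → q ∉ L → (∃ᶠ n in atTop, q ∉ C n) →
      ({q} : Set X) ∈ NBstar X := by
    intro x q hx hq hfreq
    refine singleton_mem_NBstar_of_frequently hmeet (ne_of_mem_of_not_mem hx hq)
      ((hfreq.and_eventually hCL).mono fun n hn => ⟨L ∪ C n, hLc.union (hC n).1,
        hLconn.union hn.2 (hC n).2.1, Or.inl hx, not_or.2 ⟨hq, hn.1⟩, subset_union_right⟩)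
  obtain ⟨x, hx⟩ := hLconn.nonempty
  have hpL : p ∈ L := by
    by_contra hp
    exact hpNB (hunion hx hp (Frequently.of_forall hpC))
  have hsing : ∀ q ∈ Lᶜ, ({q} : Set X) ∈ NBstar X := by
    intro q hq
    refine hunion hx hq fun hev => hpNB ?_
    refine singleton_mem_NBstar_of_frequently hmeet (x := q)
      (ne_of_mem_of_not_mem hpL hq).symm (Eventually.frequently ?_)
    filter_upwards [hev] with n hn
    exact ⟨C n, (hC n).1, (hC n).2.1, not_not.1 hn, hpC n, subset_rfl⟩
  have hinf : Lᶜ.Infinite := by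
    intro hfin
    rcases isClopen_iff.1 ⟨hfin.isClosed, hLo⟩ with h | h
    · exact hLprop (compl_empty_iff.1 h)
    · exact (h.symm.subset (mem_univ x)) hx
  exact (hinf.image singleton_injective.injOn).mono (image_subset_iff.2 hsing)
end

section
/- Let X be an irreducible continuum and let p ∈ X be such that X \ κ(p) is nonempty and compact. If A is a subcontinuum of X with X \ κ(p) contained in the interior of A, then A is decomposable. -/
open Set Filter Metric

/-- If `S` is a connected closed subset of a connected closed set `T` and `T \ S` splits into
the pieces cut out by disjoint open sets `u` and `v`, then `S` together with the piece in `u`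
is connected. -/
theorem isPreconnected_diff_diff {X : Type*} [TopologicalSpace X] {T S u v : Set X}
    (hT : IsPreconnected T) (hTc : IsClosed T) (hS : IsPreconnected S) (hST : S ⊆ T)
    (hSc : IsClosed S) (hu : IsOpen u) (hv : IsOpen v) (huv : T \ S ⊆ u ∪ v)
    (hd : T \ S ∩ (u ∩ v) = ∅) : IsPreconnected (T \ (v \ S)) := by
  have hW : IsClosed (T \ (v \ S)) := hTc.sdiff (hv.sdiff hSc)
  have hW' : IsClosed (T \ (u \ S)) := hTc.sdiff (hu.sdiff hSc)
  have hSW : S ⊆ T \ (v \ S) := fun x hx => ⟨hST hx, fun h => h.2 hx⟩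
  have key : ∀ a b : Set X, IsClosed a → IsClosed b → T \ (v \ S) ⊆ a ∪ b →
      T \ (v \ S) ∩ (a ∩ b) = ∅ → S ⊆ a → T \ (v \ S) ⊆ a ∨ T \ (v \ S) ⊆ b := by
    intro a b ha hb hab hdis hSa
    rw [eq_empty_iff_forall_notMem] at hdis hd
    have hinS : ∀ x, x ∈ T \ (v \ S) → x ∉ u \ S → x ∈ S := by
      intro x hx hxu
      by_contra hxS
      rcases huv ⟨hx.1, hxS⟩ with h | h
      · exact hxu ⟨h, hxS⟩
      · exact hx.2 ⟨h, hxS⟩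
    have hcov : T ⊆ ((T \ (v \ S) ∩ a) ∪ T \ (u \ S)) ∪ (T \ (v \ S) ∩ b) := by
      intro x hx
      by_cases hxv : x ∈ v \ S
      · exact Or.inl (Or.inr ⟨hx, fun hxu => hd x ⟨⟨hx, hxu.2⟩, hxu.1, hxv.1⟩⟩)
      · rcases hab ⟨hx, hxv⟩ with h | h
        · exact Or.inl (Or.inl ⟨⟨hx, hxv⟩, h⟩)
        · exact Or.inr ⟨⟨hx, hxv⟩, h⟩
    have hdisj : T ∩ (((T \ (v \ S) ∩ a) ∪ T \ (u \ S)) ∩ (T \ (v \ S) ∩ b)) = ∅ := by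
      rw [eq_empty_iff_forall_notMem]
      rintro x ⟨-, h | h, hW, hb⟩
      · exact hdis x ⟨hW, h.2, hb⟩
      · exact hdis x ⟨hW, hSa (hinS x hW h.2), hb⟩
    rcases isPreconnected_iff_subset_of_disjoint_closed.1 hT _ _
      ((hW.inter ha).union hW') (hW.inter hb) hcov hdisj with h | h
    · left
      intro x hx
      rcases h hx.1 with h' | h'
      · exact h'.2
      · exact hSa (hinS x hx h'.2)
    · exact Or.inr fun x hx => (h hx.1).2
  refine isPreconnected_iff_subset_of_disjoint_closed.2 fun a b ha hb hab hdis => ?_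
  rcases isPreconnected_iff_subset_of_disjoint_closed.1 hS a b ha hb (hSW.trans hab)
    (subset_empty_iff.1 ((inter_subset_inter_left _ hSW).trans hdis.subset)) with h | h
  · exact key a b ha hb hab hdis h
  · exact (key b a hb ha (by rwa [union_comm]) (by rwa [inter_comm b a]) h).symm

/-- A proper subcontinuum of an indecomposable continuum has dense complement. -/
theorem subset_closure_diff_of_not_decomposableSet {X : Type*} [TopologicalSpace X] [T2Space X]
    {A M : Set X} (hA : ¬ DecomposableSet A) (hAc : IsCompact A) (hAconn : IsConnected A)
    (hM : IsCompact M) (hMconn : IsConnected M) (hMA : M ⊆ A) (hne : M ≠ A) :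
    A ⊆ closure (A \ M) := by
  have hnon : (A \ M).Nonempty := by
    rw [nonempty_iff_ne_empty, Ne, sdiff_eq_empty]
    exact fun h => hne (hMA.antisymm h)
  have hcl : closure (A \ M) ⊆ A := closure_minimal sdiff_subset hAc.isClosed
  by_cases hp : IsPreconnected (A \ M)
  · by_contra hcon
    refine hA ⟨M, closure (A \ M), hM, hMconn, hMA, hne,
      hAc.of_isClosed_subset isClosed_closure hcl, ⟨hnon.closure, hp.closure⟩, hcl,
      fun h => hcon h.ge, (union_subset hMA hcl).antisymm fun x hx => ?_⟩
    by_cases hxM : x ∈ M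
    · exact Or.inl hxM
    · exact Or.inr (subset_closure ⟨hx, hxM⟩)
  · exfalso
    simp only [IsPreconnected, not_forall, not_nonempty_iff_eq_empty] at hp
    obtain ⟨u, v, hu, hv, huv, ⟨y, hyA, hyu⟩, ⟨z, hzA, hzv⟩, hd⟩ := hp
    have hsubM : ∀ w : Set X, M ⊆ A \ (w \ M) := fun w x hx => ⟨hMA hx, fun h => h.2 hx⟩
    have hcpt : ∀ w : Set X, IsOpen w → IsCompact (A \ (w \ M)) :=
      fun w hw => hAc.diff (hw.sdiff hM.isClosed)
    refine hA ⟨A \ (v \ M), A \ (u \ M), hcpt v hv,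
      ⟨hMconn.nonempty.mono (hsubM v), isPreconnected_diff_diff hAconn.isPreconnected
        hAc.isClosed hMconn.isPreconnected hMA hM.isClosed hu hv huv hd⟩, sdiff_subset, ?_,
      hcpt u hu,
      ⟨hMconn.nonempty.mono (hsubM u), isPreconnected_diff_diff hAconn.isPreconnected
        hAc.isClosed hMconn.isPreconnected hMA hM.isClosed hv hu (by rwa [union_comm])
        (by rwa [inter_comm v u])⟩, sdiff_subset, ?_,
      (union_subset sdiff_subset sdiff_subset).antisymm fun x hx => ?_⟩
    · exact fun h => (h.ge hzA.1).2 ⟨hzv, hzA.2⟩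
    · exact fun h => (h.ge hyA.1).2 ⟨hyu, hyA.2⟩
    · by_cases hxv : x ∈ v \ M
      · refine Or.inr ⟨hx, fun hxu => ?_⟩
        exact (eq_empty_iff_forall_notMem.1 hd) x ⟨⟨hx, hxu.2⟩, hxu.1, hxv.1⟩
      · exact Or.inl ⟨hx, hxv⟩

theorem IrrBetween.symm {X : Type*} [TopologicalSpace X] {p q : X} (h : IrrBetween p q) :
    IrrBetween q p :=
  fun L hL hLc hq hp => h L hL hLc hp hq

/-- In a continuum irreducible between `p` and `q`, the complement of a subcontinuum
containing `p` is connected. -/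
theorem IrrBetween.isPreconnected_compl {X : Type*} [TopologicalSpace X] [T2Space X]
    [CompactSpace X] [ConnectedSpace X] {p q : X} (h : IrrBetween p q) {L : Set X}
    (hL : IsCompact L) (hLc : IsConnected L) (hp : p ∈ L) : IsPreconnected Lᶜ := by
  intro u v hu hv huv ⟨y, hyL, hyu⟩ ⟨z, hzL, hzv⟩
  by_contra hd
  rw [not_nonempty_iff_eq_empty] at hd
  have key : ∀ u v : Set X, IsOpen u → IsOpen v → Lᶜ ⊆ u ∪ v → Lᶜ ∩ (u ∩ v) = ∅ →
      q ∉ v \ L → ∀ z ∉ L, z ∉ v := by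
    intro u v hu hv huv hd hq z hzL hzv
    rw [compl_eq_univ_sdiff] at huv hd
    have hpre := isPreconnected_diff_diff isPreconnected_univ isClosed_univ
      hLc.isPreconnected (subset_univ L) hL.isClosed hu hv huv hd
    have hpW : p ∈ univ \ (v \ L) := ⟨mem_univ p, fun h => h.2 hp⟩
    have hW := h _ (isCompact_univ.diff (hv.sdiff hL.isClosed)) ⟨⟨p, hpW⟩, hpre⟩
      hpW ⟨mem_univ q, hq⟩
    exact (hW.ge (mem_univ z)).2 ⟨hzv, hzL⟩
  by_cases hq : q ∈ v \ L
  · refine key v u hv hu (by rwa [union_comm]) (by rwa [inter_comm v u]) (fun hqu => ?_)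
      y hyL hyu
    exact (eq_empty_iff_forall_notMem.1 hd) q ⟨hq.2, hqu.1, hq.1⟩
  · exact key u v hu hv huv hd hq z hzL hzv

theorem irrBetween_of_notMem_composant {X : Type*} [TopologicalSpace X] {p q : X}
    (h : q ∉ composant p) : IrrBetween p q := by
  intro L hL hLc hp hq
  by_contra hne
  exact h ⟨L, ⟨hL, hLc, hne, hp⟩, hq⟩

/-- If `A` is an indecomposable continuum containing in its interior a point `q` such that the
space is irreducible between `p` and `q`, then every proper subcontinuum of the space containing
`p` has dense complement in `A`. -/
theorem IrrBetween.subset_closure_diff {X : Type*} [TopologicalSpace X] [T2Space X]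
    [CompactSpace X] [ConnectedSpace X] {p q : X} (h : IrrBetween p q) {A L : Set X}
    (hA : ¬ DecomposableSet A) (hAc : IsCompact A) (hAconn : IsConnected A)
    (hq : q ∈ interior A) (hL : IsCompact L) (hLc : IsConnected L) (hne : L ≠ univ)
    (hp : p ∈ L) : A ⊆ closure (A \ L) := by
  have hqL : q ∉ L := fun hq => hne (h L hL hLc hp hq)
  have hL'p : p ∈ L ∪ closure Aᶜ := Or.inl hp
  have hL'pre : IsPreconnected (L ∪ closure Aᶜ) := by
    by_cases hpA : p ∈ A
    · rw [h A hAc hAconn hpA (interior_subset hq)]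
      simpa using hLc.isPreconnected
    · exact hLc.isPreconnected.union p hp (subset_closure hpA)
        (h.symm.isPreconnected_compl hAc hAconn (interior_subset hq)).closure
  have hL'cl : IsClosed (L ∪ closure Aᶜ) := hL.isClosed.union isClosed_closure
  have hqL' : q ∈ (L ∪ closure Aᶜ)ᶜ := by
    rintro (h | h)
    · exact hqL h
    · rw [closure_compl] at h
      exact h hq
  have hsub : (L ∪ closure Aᶜ)ᶜ ⊆ A \ L := by
    intro x hx
    refine ⟨?_, fun h => hx (Or.inl h)⟩
    by_contra hxA
    exact hx (Or.inr (subset_closure hxA))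
  have hMA : closure (L ∪ closure Aᶜ)ᶜ ⊆ A :=
    closure_minimal (hsub.trans sdiff_subset) hAc.isClosed
  have hMconn : IsConnected (closure (L ∪ closure Aᶜ)ᶜ) :=
    ⟨⟨q, subset_closure hqL'⟩,
      (h.isPreconnected_compl hL'cl.isCompact ⟨⟨p, hL'p⟩, hL'pre⟩ hL'p).closure⟩
  by_cases hM : closure (L ∪ closure Aᶜ)ᶜ = A
  · exact hM.ge.trans (closure_mono hsub)
  · have hdense := subset_closure_diff_of_not_decomposableSet hA hAc hAconn
      isClosed_closure.isCompact hMconn hMA hM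
    obtain ⟨x, hx, -, hxM⟩ :=
      mem_closure_iff.1 (hdense (interior_subset hq)) _ hL'cl.isOpen_compl hqL'
    exact absurd (subset_closure hx) hxM

/-- A composant with compact complement is covered by countably many proper subcontinua. -/
theorem exists_composant_subset_iUnion {X : Type*} [MetricSpace X] [CompactSpace X] {p : X}
    (h1 : (composant p)ᶜ.Nonempty) (h2 : IsCompact (composant p)ᶜ) (hp : p ∈ composant p) :
    ∃ C : ℕ → Set X, composant p ⊆ ⋃ n, C n ∧
      ∀ n, IsCompact (C n) ∧ IsConnected (C n) ∧ C n ≠ univ ∧ p ∈ C n := by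
  obtain ⟨q, hq⟩ := h1
  have hex : ∀ L : Set X, IsCompact L → IsConnected L → L ≠ univ → p ∈ L →
      ∃ δ > 0, L ⊆ (thickening δ (composant p)ᶜ)ᶜ := by
    intro L hL hLc hne hpL
    have hsub : (composant p)ᶜ ⊆ Lᶜ :=
      compl_subset_compl.2 fun x hx => ⟨L, ⟨hL, hLc, hne, hpL⟩, hx⟩
    obtain ⟨δ, hδ, h⟩ := h2.exists_thickening_subset_open hL.isClosed.isOpen_compl hsub
    exact ⟨δ, hδ, subset_compl_comm.1 h⟩
  have hpq : ({p} : Set X) ≠ univ := by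
    intro h
    have : q ∈ ({p} : Set X) := h ▸ mem_univ q
    exact hq (mem_singleton_iff.1 this ▸ hp)
  obtain ⟨ε, hε, hεp⟩ := hex {p} isCompact_singleton isConnected_singleton hpq rfl
  have hpos : ∀ n : ℕ, 0 < min ε (1 / ((n : ℝ) + 1)) := fun n => lt_min hε (by positivity)
  have hpF : ∀ n : ℕ, p ∈ (thickening (min ε (1 / ((n : ℝ) + 1))) (composant p)ᶜ)ᶜ :=
    fun n h => hεp rfl (thickening_mono (min_le_left _ _) _ h)
  refine ⟨fun n => connectedComponentIn
    (thickening (min ε (1 / ((n : ℝ) + 1))) (composant p)ᶜ)ᶜ p, ?_, fun n => ⟨?_, ?_, ?_, ?_⟩⟩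
  · rintro x ⟨L, ⟨hL, hLc, hne, hpL⟩, hx⟩
    obtain ⟨δ, hδ, h⟩ := hex L hL hLc hne hpL
    obtain ⟨n, hn⟩ := exists_nat_one_div_lt hδ
    refine mem_iUnion.2 ⟨n, hLc.isPreconnected.subset_connectedComponentIn hpL
      (h.trans (compl_subset_compl.2 (thickening_mono ?_ _))) hx⟩
    exact (min_le_right _ _).trans hn.le
  · refine IsClosed.isCompact (closure_subset_iff_isClosed.1 ?_)
    exact isPreconnected_connectedComponentIn.closure.subset_connectedComponentIn
      (subset_closure (mem_connectedComponentIn (hpF n)))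
      (closure_minimal (connectedComponentIn_subset _ _) isOpen_thickening.isClosed_compl)
  · exact isConnected_connectedComponentIn_iff.2 (hpF n)
  · intro h
    exact connectedComponentIn_subset _ _ (h.ge (mem_univ q))
      (self_subset_thickening (hpos n) _ hq)
  · exact mem_connectedComponentIn (hpF n)

theorem stmt4 (X : Type*) [MetricSpace X] [CompactSpace X] [ConnectedSpace X] [Nonempty X]
    (hirr : ∃ p q : X, p ≠ q ∧ IrrBetween p q)
    (p : X) (h1 : (composant p)ᶜ.Nonempty) (h2 : IsCompact (composant p)ᶜ)
    (A : Set X) (hAc : IsCompact A) (hAconn : IsConnected A)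
    (hsub : (composant p)ᶜ ⊆ interior A) :
    DecomposableSet A := by
  by_contra hA
  obtain ⟨q, hq⟩ := h1
  have hpc : p ∈ composant p := by
    refine ⟨{p}, ⟨isCompact_singleton, isConnected_singleton, fun h => ?_, rfl⟩, rfl⟩
    obtain ⟨a, b, hab, -⟩ := hirr
    have ha : a ∈ ({p} : Set X) := h ▸ mem_univ a
    have hb : b ∈ ({p} : Set X) := h ▸ mem_univ b
    exact hab (ha.trans hb.symm)
  obtain ⟨C, hcover, hC⟩ := exists_composant_subset_iUnion ⟨q, hq⟩ h2 hpc
  have hdense : ∀ n, Dense (C n ∩ A)ᶜ := by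
    intro n
    rw [← interior_eq_empty_iff_dense_compl, eq_empty_iff_forall_notMem]
    intro x hx
    obtain ⟨hCc, hCconn, hne, hpC⟩ := hC n
    have hcl := (irrBetween_of_notMem_composant hq).subset_closure_diff hA hAc hAconn
      (hsub hq) hCc hCconn hne hpC (interior_subset hx).2
    obtain ⟨y, hy, hyA⟩ := mem_closure_iff.1 hcl _ isOpen_interior hx
    exact hyA.2 (interior_subset hy).1
  have hbaire : Dense (⋂ n, (C n ∩ A)ᶜ) :=
    dense_iInter_of_isOpen
      (fun n => ((hC n).1.isClosed.inter hAc.isClosed).isOpen_compl) hdense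
  have hopen : IsOpen (composant p) := isClosed_compl_iff.1 h2.isClosed
  have hnon : (interior A ∩ composant p).Nonempty := by
    by_contra hemp
    have heq : (composant p)ᶜ = interior A :=
      hsub.antisymm fun x hx hxp => hemp ⟨x, hx, hxp⟩
    have hclopen : IsClopen (composant p)ᶜ := ⟨h2.isClosed, heq ▸ isOpen_interior⟩
    have huniv := hclopen.eq_univ ⟨q, hq⟩
    exact (huniv.ge (mem_univ p)) hpc
  obtain ⟨x, ⟨hxA, hxp⟩, hx⟩ := hbaire.inter_open_nonempty _ (isOpen_interior.inter hopen) hnon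
  obtain ⟨n, hn⟩ := mem_iUnion.1 (hcover hxp)
  exact mem_iInter.1 hx n ⟨hn, interior_subset hxA⟩
end

section
/- Let X be a decomposable continuum that is irreducible between points p and q, and let A be a nonempty proper closed subset of X. If A does not block x for every x ∈ (κ(p) ∩ κ(q)) \ A, then A ⊆ cl(X \ κ(p)) ∪ cl(X \ κ(q)). -/
open Set Filter Metric

/-- Boundary bumping: in a compact connected Hausdorff space, the component of a point in the
complement of a nonempty open set reaches the closure of that set. -/
theorem exists_continuum_inter_closure_nonempty {X : Type*} [TopologicalSpace X] [T2Space X]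
    [CompactSpace X] [PreconnectedSpace X] {V : Set X} (hV : IsOpen V) (hVne : V.Nonempty)
    {x : X} (hx : x ∉ V) :
    ∃ C : Set X, IsCompact C ∧ IsConnected C ∧ x ∈ C ∧ Disjoint C V ∧
      (C ∩ closure V).Nonempty := by
  have : CompactSpace ↥(Vᶜ) := isCompact_iff_compactSpace.mp hV.isClosed_compl.isCompact
  let x' : ↥(Vᶜ) := ⟨x, hx⟩
  refine ⟨(↑) '' connectedComponent x',
    isClosed_connectedComponent.isCompact.image continuous_subtype_val,
    isConnected_connectedComponent.image _ continuous_subtype_val.continuousOn,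
    ⟨x', mem_connectedComponent, rfl⟩, ?_, ?_⟩
  · rw [Set.disjoint_left]
    rintro _ ⟨y, -, rfl⟩
    exact y.2
  by_contra hne
  have hsub : connectedComponent x' ⊆ (↑) ⁻¹' (closure V)ᶜ := fun y hy hyV =>
    hne ⟨y, ⟨y, hy, rfl⟩, hyV⟩
  have hopen : IsOpen ((↑) ⁻¹' (closure V)ᶜ : Set ↥(Vᶜ)) :=
    isClosed_closure.isOpen_compl.preimage continuous_subtype_val
  rw [connectedComponent_eq_iInter_isClopen] at hsub
  have : Nonempty { s : Set ↥(Vᶜ) // IsClopen s ∧ x' ∈ s } :=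
    ⟨⟨univ, isClopen_univ, mem_univ x'⟩⟩
  obtain ⟨⟨Z, hZ, hxZ⟩, hZsub⟩ := exists_subset_nhds_of_compactSpace
    (V := fun s : { s : Set ↥(Vᶜ) // IsClopen s ∧ x' ∈ s } => (s : Set ↥(Vᶜ)))
    (by
      rintro ⟨s, hs, hxs⟩ ⟨t, ht, hxt⟩
      exact ⟨⟨s ∩ t, hs.inter ht, hxs, hxt⟩, inter_subset_left, inter_subset_right⟩)
    (fun s => s.2.1.isClosed) (fun y hy => hopen.mem_nhds (hsub hy))
  obtain ⟨O, hO, rfl⟩ := isOpen_induced_iff.mp hZ.isOpen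
  have himage : ((↑) '' ((↑) ⁻¹' O : Set ↥(Vᶜ)) : Set X) = O ∩ (closure V)ᶜ := by
    ext y
    constructor
    · rintro ⟨z, hz, rfl⟩
      exact ⟨hz, hZsub hz⟩
    · rintro ⟨hyO, hyV⟩
      exact ⟨⟨y, fun hy => hyV (subset_closure hy)⟩, hyO, rfl⟩
  have hclopen : IsClopen (O ∩ (closure V)ᶜ) :=
    ⟨himage ▸ (hZ.isClosed.isCompact.image continuous_subtype_val).isClosed,
      hO.inter isClosed_closure.isOpen_compl⟩
  obtain ⟨v, hv⟩ := hVne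
  have huniv := hclopen.eq_univ ⟨x, hxZ, hZsub hxZ⟩
  exact (huniv.symm ▸ mem_univ v : v ∈ O ∩ (closure V)ᶜ).2 (subset_closure hv)

theorem mem_composant {X : Type*} [TopologicalSpace X] [Nontrivial X] (z : X) :
    z ∈ composant z :=
  ⟨{z}, ⟨isCompact_singleton, isConnected_singleton, singleton_ne_univ z, rfl⟩, rfl⟩

theorem subset_composant {X : Type*} [TopologicalSpace X] {z : X} {L : Set X}
    (hc : IsCompact L) (hconn : IsConnected L) (hL : L ≠ univ) (hz : z ∈ L) :
    L ⊆ composant z :=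
  subset_sUnion_of_mem ⟨hc, hconn, hL, hz⟩

theorem IrrBetween.notMem_composant {X : Type*} [TopologicalSpace X] {p q : X}
    (h : IrrBetween p q) : q ∉ composant p := by
  rintro ⟨L, ⟨hc, hconn, hL, hp⟩, hq⟩
  exact hL (h L hc hconn hp hq)

theorem dense_composant {X : Type*} [TopologicalSpace X] [T2Space X] [CompactSpace X]
    [PreconnectedSpace X] [Nontrivial X] (z : X) : Dense (composant z) := by
  rw [dense_iff_inter_open]
  rintro W hW ⟨y, hy⟩
  by_cases hz : z ∈ W
  · exact ⟨z, hz, mem_composant z⟩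
  obtain ⟨V, ⟨hyV, hV⟩, hVW⟩ := (hasBasis_opens_closure y).mem_iff.mp (hW.mem_nhds hy)
  obtain ⟨C, hCc, hCconn, hzC, hdisj, c, hcC, hcV⟩ :=
    exists_continuum_inter_closure_nonempty hV ⟨y, hyV⟩ (fun h => hz (hVW (subset_closure h)))
  refine ⟨c, hVW hcV, subset_composant hCc hCconn ?_ hzC hcC⟩
  rintro rfl
  exact Set.disjoint_left.mp hdisj (mem_univ y) hyV

/-- In an irreducible continuum, a point outside the closure of the complement of the composant
of `p` is avoided by a subcontinuum with nonempty interior containing `q`. -/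
theorem IrrBetween.exists_continuum_notMem {X : Type*} [TopologicalSpace X] [T2Space X]
    [CompactSpace X] [PreconnectedSpace X] {p q a : X} (h : IrrBetween p q)
    (ha : a ∉ closure (composant p)ᶜ) :
    ∃ C : Set X, IsCompact C ∧ IsConnected C ∧ q ∈ C ∧ a ∉ C ∧ (interior C).Nonempty := by
  obtain ⟨V, ⟨haV, hV⟩, hVsub⟩ := (hasBasis_opens_closure a).mem_iff.mp
    (isClosed_closure.isOpen_compl.mem_nhds ha)
  have hVp : closure V ⊆ composant p := fun y hy => by
    by_contra hyp
    exact hVsub hy (subset_closure hyp)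
  obtain ⟨C, hCc, hCconn, hqC, hdisj, c, hcC, hcV⟩ :=
    exists_continuum_inter_closure_nonempty hV ⟨a, haV⟩
      (fun hq => h.notMem_composant (hVp (subset_closure hq)))
  obtain ⟨L, ⟨hLc, hLconn, hL, hpL⟩, hcL⟩ := hVp hcV
  have hLC : L ∪ C = univ :=
    h _ (hLc.union hCc) (IsConnected.union ⟨c, hcL, hcC⟩ hLconn hCconn) (Or.inl hpL)
      (Or.inr hqC)
  refine ⟨C, hCc, hCconn, hqC, fun haC => Set.disjoint_left.mp hdisj haC haV, ?_⟩
  have hsub : Lᶜ ⊆ interior C := by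
    refine interior_maximal (fun y hy => ?_) hLc.isClosed.isOpen_compl
    exact (hLC.symm ▸ mem_univ y : y ∈ L ∪ C).resolve_left hy
  exact (nonempty_compl.mpr hL).mono hsub

/-- In a decomposable irreducible continuum, the composants of two points of irreducibility
have dense intersection. -/
theorem IrrBetween.dense_composant_inter {X : Type*} [TopologicalSpace X] [T2Space X]
    [CompactSpace X] [PreconnectedSpace X] [Nontrivial X] {p q : X} (h : IrrBetween p q)
    (hdec : DecomposableSet (univ : Set X)) : Dense (composant p ∩ composant q) := by
  obtain ⟨M, N, hMc, hMconn, hM, hNc, hNconn, hN, hMN, hpM, hqN⟩ :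
      ∃ M N : Set X, IsCompact M ∧ IsConnected M ∧ M ≠ univ ∧ IsCompact N ∧ IsConnected N ∧
        N ≠ univ ∧ M ∪ N = univ ∧ p ∈ M ∧ q ∈ N := by
    obtain ⟨M, N, hMc, hMconn, -, hM, hNc, hNconn, -, hN, hMN⟩ := hdec
    have hmem (x : X) : x ∈ M ∨ x ∈ N := (hMN.symm ▸ mem_univ x : x ∈ M ∪ N)
    rcases hmem p with hp | hp <;> rcases hmem q with hq | hq
    · exact absurd (h M hMc hMconn hp hq) hM
    · exact ⟨M, N, hMc, hMconn, hM, hNc, hNconn, hN, hMN, hp, hq⟩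
    · exact ⟨N, M, hNc, hNconn, hN, hMc, hMconn, hM, union_comm M N ▸ hMN, hp, hq⟩
    · exact absurd (h N hNc hNconn hp hq) hN
  have hMp := subset_composant hMc hMconn hM hpM
  have hNq := subset_composant hNc hNconn hN hqN
  have hmem (x : X) : x ∈ M ∨ x ∈ N := (hMN.symm ▸ mem_univ x : x ∈ M ∪ N)
  rw [dense_iff_inter_open]
  rintro W hW ⟨w, hw⟩
  by_cases hwM : w ∈ M
  · by_cases hwN : w ∈ N
    · exact ⟨w, hw, hMp hwM, hNq hwN⟩
    · obtain ⟨z, ⟨hzW, hzN⟩, hz⟩ := (dense_composant q).inter_open_nonempty (W ∩ Nᶜ)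
        (hW.inter hNc.isClosed.isOpen_compl) ⟨w, hw, hwN⟩
      exact ⟨z, hzW, hMp ((hmem z).resolve_right hzN), hz⟩
  · obtain ⟨z, ⟨hzW, hzM⟩, hz⟩ := (dense_composant p).inter_open_nonempty (W ∩ Mᶜ)
      (hW.inter hMc.isClosed.isOpen_compl) ⟨w, hw, hwM⟩
    exact ⟨z, hzW, hz, hNq ((hmem z).resolve_left hzM)⟩

theorem stmt6 (X : Type*) [MetricSpace X] [CompactSpace X] [ConnectedSpace X] [Nonempty X]
    (p q : X) (hdec : DecomposableSet (univ : Set X)) (hirr : IrrBetween p q)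
    (A : Set X) (hAne : A.Nonempty) (hAprop : A ≠ univ) (hAcl : IsClosed A)
    (h : ∀ x ∈ (composant p ∩ composant q) \ A, NotBlocks A x) :
    A ⊆ closure (composant p)ᶜ ∪ closure (composant q)ᶜ := by
  intro a haA
  by_contra hcon
  rw [mem_union, not_or] at hcon
  obtain ⟨b, hb⟩ := nonempty_compl.mpr hAprop
  have : Nontrivial X := ⟨a, b, fun hab => hb (hab ▸ haA)⟩
  obtain ⟨x, hxA, hx⟩ := (hirr.dense_composant_inter hdec).inter_open_nonempty Aᶜ
    hAcl.isOpen_compl ⟨b, hb⟩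
  obtain ⟨C, hCc, hCconn, hqC, haC, hCint⟩ := hirr.exists_continuum_notMem hcon.1
  obtain ⟨D, hDc, hDconn, hpD, haD, hDint⟩ := hirr.symm.exists_continuum_notMem hcon.2
  have hdense : Dense _ := h x ⟨hx, hxA⟩
  obtain ⟨y, hyC, K, ⟨hKc, hKconn, hxK, hKA⟩, hyK⟩ :=
    hdense.inter_open_nonempty _ isOpen_interior hCint
  obtain ⟨z, hzD, K', ⟨hKc', hKconn', hxK', hKA'⟩, hzK'⟩ :=
    hdense.inter_open_nonempty _ isOpen_interior hDint
  have hconnC : IsConnected (C ∪ K) :=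
    IsConnected.union ⟨y, interior_subset hyC, hyK⟩ hCconn hKconn
  have hconnD : IsConnected (D ∪ K') :=
    IsConnected.union ⟨z, interior_subset hzD, hzK'⟩ hDconn hKconn'
  have huniv : (C ∪ K) ∪ (D ∪ K') = univ :=
    hirr _ ((hCc.union hKc).union (hDc.union hKc'))
      (IsConnected.union ⟨x, Or.inr hxK, Or.inr hxK'⟩ hconnC hconnD)
      (Or.inr (Or.inl hpD)) (Or.inl (Or.inl hqC))
  rcases (huniv.symm ▸ mem_univ a : a ∈ (C ∪ K) ∪ (D ∪ K')) with (h1 | h1) | (h1 | h1)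
  · exact haC h1
  · exact hKA h1 haA
  · exact haD h1
  · exact hKA' h1 haA
end

section
/- Let X be a decomposable continuum that is irreducible between points p and q, and let A be a nonempty closed subset of X. If A ⊆ (X \ κ(p)) ∪ (X \ κ(q)), then A does not block x for every x ∈ κ(p) ∩ κ(q). -/
open Set Filter Metric

theorem exists_isClopen_disjoint_of_disjoint_connectedComponent {Y : Type*} [TopologicalSpace Y]
    [CompactSpace Y] [T2Space Y] {y : Y} {Z : Set Y} (hZ : IsClosed Z)
    (hd : Disjoint (connectedComponent y) Z) : ∃ S : Set Y, IsClopen S ∧ y ∈ S ∧ Disjoint S Z := by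
  rw [connectedComponent_eq_iInter_isClopen, Set.disjoint_iff_inter_eq_empty, inter_comm] at hd
  obtain ⟨u, hu⟩ := hZ.isCompact.elim_finite_subfamily_closed _ (fun s => s.2.1.1) hd
  refine ⟨⋂ i ∈ u, (i : Set Y), u.finite_toSet.isClopen_biInter fun i _ => i.2.1,
    mem_iInter₂.2 fun i _ => i.2.2, ?_⟩
  rw [Set.disjoint_iff_inter_eq_empty, inter_comm]
  exact hu

/-- Boundary bumping: if a continuum `Q` meets a closed set `A`, then the subcontinua of `Q` that
contain a given point of `Q` and avoid `A` accumulate at `A`. -/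
theorem closure_sUnion_subcontinua_inter_nonempty {X : Type*} [TopologicalSpace X] [T2Space X]
    [NormalSpace X] {Q A : Set X} {x : X} (hQ : IsCompact Q) (hQc : IsConnected Q) (hx : x ∈ Q)
    (hxA : x ∉ A) (hA : IsClosed A) (hQA : (Q ∩ A).Nonempty) :
    (closure (⋃₀ {K : Set X | IsCompact K ∧ IsConnected K ∧ x ∈ K ∧ K ⊆ Q ∧ K ⊆ Aᶜ}) ∩
      A).Nonempty := by
  set E := closure (⋃₀ {K : Set X | IsCompact K ∧ IsConnected K ∧ x ∈ K ∧ K ⊆ Q ∧ K ⊆ Aᶜ})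
  have hle : ∀ K : Set X, IsCompact K → IsConnected K → x ∈ K → K ⊆ Q → K ⊆ Aᶜ → K ⊆ E :=
    fun K h₁ h₂ h₃ h₄ h₅ z hz => subset_closure ⟨K, ⟨h₁, h₂, h₃, h₄, h₅⟩, hz⟩
  by_contra hne
  have hAE : A ⊆ Eᶜ := fun a ha haE => hne ⟨a, haE, ha⟩
  obtain ⟨V, hV, hAV, hVE⟩ := normal_exists_closure_subset hA isClosed_closure.isOpen_compl hAE
  have hxE : x ∈ E := hle {x} isCompact_singleton isConnected_singleton rfl
    (singleton_subset_iff.2 hx) (singleton_subset_iff.2 hxA) rfl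
  have hxV : x ∉ V := fun hxV => hVE (subset_closure hxV) hxE
  have hYc : IsCompact (Q \ V) := hQ.diff hV
  have : CompactSpace ↥(Q \ V) := isCompact_iff_compactSpace.1 hYc
  let y : ↥(Q \ V) := ⟨x, hx, hxV⟩
  have hCE : Subtype.val '' connectedComponent y ⊆ E := by
    refine hle _ (isClosed_connectedComponent.isCompact.image continuous_subtype_val)
      (isConnected_connectedComponent.image _ continuous_subtype_val.continuousOn)
      ⟨y, mem_connectedComponent, rfl⟩ ?_ ?_
    · rintro _ ⟨z, -, rfl⟩
      exact z.2.1
    · rintro _ ⟨z, -, rfl⟩ hzA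
      exact z.2.2 (hAV hzA)
  obtain ⟨S, hS, hyS, hSV⟩ := exists_isClopen_disjoint_of_disjoint_connectedComponent (y := y)
    (isClosed_closure.preimage continuous_subtype_val : IsClosed (Subtype.val ⁻¹' closure V))
    (Set.disjoint_left.2 fun z hz hzV => hVE hzV (hCE ⟨z, hz, rfl⟩))
  obtain ⟨a, haQ, haA⟩ := hQA
  have hcl : ∀ T : Set ↥(Q \ V), IsClosed T → IsClosed (Subtype.val '' T) := fun T hT =>
    (hT.isCompact.image continuous_subtype_val).isClosed
  obtain ⟨z, -, ⟨s, hs, rfl⟩, hz⟩ := isPreconnected_closed_iff.1 hQc.isPreconnected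
    (Subtype.val '' S) (Subtype.val '' Sᶜ ∪ closure V) (hcl S hS.1)
    ((hcl _ hS.compl.1).union isClosed_closure)
    (fun z hz => by
      by_cases hzV : z ∈ V
      · exact Or.inr (Or.inr (subset_closure hzV))
      · by_cases hzS : (⟨z, hz, hzV⟩ : ↥(Q \ V)) ∈ S
        · exact Or.inl ⟨_, hzS, rfl⟩
        · exact Or.inr (Or.inl ⟨_, hzS, rfl⟩))
    ⟨x, hx, y, hyS, rfl⟩ ⟨a, haQ, Or.inr (subset_closure (hAV haA))⟩
  rcases hz with ⟨t, ht, hts⟩ | hz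
  · exact ht (Subtype.ext hts ▸ hs)
  · exact Set.disjoint_left.1 hSV hs hz

/-- If `P` and `Q` are proper subcontinua joining `x` to `p` and to `q` respectively, and no point
of `A` lies in both composants, then the subcontinua that contain `x` and avoid `A` accumulate
at `q`. -/
theorem IrrBetween.mem_closure_sUnion_subcontinua {X : Type*} [TopologicalSpace X] [CompactSpace X]
    [T2Space X] {p q x : X} {A P Q : Set X} (hirr : IrrBetween p q) (hA : IsClosed A)
    (h : A ⊆ (composant p)ᶜ ∪ (composant q)ᶜ)
    (hP : IsCompact P) (hPc : IsConnected P) (hPne : P ≠ univ) (hpP : p ∈ P) (hxP : x ∈ P)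
    (hQ : IsCompact Q) (hQc : IsConnected Q) (hQne : Q ≠ univ) (hqQ : q ∈ Q) (hxQ : x ∈ Q) :
    q ∈ closure (⋃₀ {K : Set X | IsCompact K ∧ IsConnected K ∧ x ∈ K ∧ K ⊆ Aᶜ}) := by
  have hQκ : Q ⊆ composant q := fun _ hz => ⟨Q, ⟨hQ, hQc, hQne, hqQ⟩, hz⟩
  have hPκ : P ⊆ composant p := fun _ hz => ⟨P, ⟨hP, hPc, hPne, hpP⟩, hz⟩
  have hxA : x ∉ A := fun hxA => (h hxA).elim (fun h' => h' (hPκ hxP)) fun h' => h' (hQκ hxQ)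
  by_cases hQA : (Q ∩ A).Nonempty
  · obtain ⟨a, haE, haA⟩ :=
      closure_sUnion_subcontinua_inter_nonempty hQ hQc hxQ hxA hA hQA
    set E := closure (⋃₀ {K : Set X | IsCompact K ∧ IsConnected K ∧ x ∈ K ∧ K ⊆ Q ∧ K ⊆ Aᶜ})
    have hxE : x ∈ E := subset_closure ⟨{x}, ⟨isCompact_singleton, isConnected_singleton, rfl,
      singleton_subset_iff.2 hxQ, singleton_subset_iff.2 hxA⟩, rfl⟩
    have hEc : IsConnected E := ⟨⟨x, hxE⟩,
      (isPreconnected_sUnion x _ (fun K hK => hK.2.2.1) fun K hK => hK.2.1.isPreconnected).closure⟩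
    have hEQ : E ⊆ Q := closure_minimal (sUnion_subset fun K hK => hK.2.2.2.1) hQ.isClosed
    have haκ : a ∉ composant p :=
      (h haA).resolve_right fun h' => h' (hQκ (hEQ haE))
    have hPE : P ∪ E = univ := by
      by_contra hne
      exact haκ ⟨P ∪ E, ⟨hP.union isClosed_closure.isCompact,
        IsConnected.union ⟨x, hxP, hxE⟩ hPc hEc, hne, Or.inl hpP⟩, Or.inr haE⟩
    have hqE : q ∈ E := (hPE ▸ mem_univ q : q ∈ P ∪ E).resolve_left fun hqP =>
      hPne (hirr P hP hPc hpP hqP)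
    refine closure_mono (sUnion_subset_sUnion ?_) hqE
    exact fun K hK => ⟨hK.1, hK.2.1, hK.2.2.1, hK.2.2.2.2⟩
  · have hQA' : Q ⊆ Aᶜ := fun z hz hzA => hQA ⟨z, hz, hzA⟩
    exact subset_closure ⟨Q, ⟨hQ, hQc, hxQ, hQA'⟩, hqQ⟩

theorem stmt7 (X : Type*) [MetricSpace X] [CompactSpace X] [ConnectedSpace X] [Nonempty X]
    (p q : X) (hdec : DecomposableSet (univ : Set X)) (hirr : IrrBetween p q)
    (A : Set X) (hAne : A.Nonempty) (hAcl : IsClosed A)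
    (h : A ⊆ (composant p)ᶜ ∪ (composant q)ᶜ) :
    ∀ x ∈ composant p ∩ composant q, NotBlocks A x := by
  rintro x ⟨⟨P, ⟨hP, hPc, hPne, hpP⟩, hxP⟩, Q, ⟨hQ, hQc, hQne, hqQ⟩, hxQ⟩
  have hq := hirr.mem_closure_sUnion_subcontinua hAcl h hP hPc hPne hpP hxP hQ hQc hQne hqQ hxQ
  have hp := hirr.symm.mem_closure_sUnion_subcontinua hAcl (union_comm _ _ ▸ h)
    hQ hQc hQne hqQ hxQ hP hPc hPne hpP hxP
  refine dense_iff_closure_eq.2 (hirr _ isClosed_closure.isCompact ⟨⟨p, hp⟩, ?_⟩ hp hq)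
  exact (isPreconnected_sUnion x _ (fun K hK => hK.2.2.1)
    fun K hK => hK.2.1.isPreconnected).closure
end

section
/- Let X be a decomposable continuum that is irreducible between points p and q, and let A be a nonempty closed subset of X. If A ∩ (X \ κ(q)) ≠ ∅ and there exists w ∈ (X \ κ(q)) \ A, then A blocks w, i.e., the union of all subcontinua of X that contain w and are contained in X \ A is not dense in X. -/
open Set Filter Metric

/-- If `X = M ∪ N` with proper subcontinua `M ∋ q` and `N`, then a set meeting the complement of
the composant of `q` blocks every other point of that complement. -/
theorem not_notBlocks_of_cover {X : Type*} [TopologicalSpace X] [T2Space X] {q w : X}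
    {M N A : Set X} (hMc : IsCompact M) (hM : IsConnected M) (hMu : M ≠ univ) (hq : q ∈ M)
    (hNc : IsCompact N) (hNu : N ≠ univ) (hMN : M ∪ N = univ)
    (hA : (A ∩ (composant q)ᶜ).Nonempty) (hw : w ∉ composant q) : ¬ NotBlocks A w := by
  intro hd
  obtain ⟨a, haA, haq⟩ := hA
  obtain ⟨y, hyN, K, ⟨hKc, hK, hwK, hKA⟩, hyK⟩ :=
    hd.inter_open_nonempty Nᶜ hNc.isClosed.isOpen_compl (nonempty_compl.mpr hNu)
  have hyM : y ∈ M := (hMN.symm ▸ mem_univ y : y ∈ M ∪ N).resolve_right hyN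
  have hKM : K ∪ M = univ := by
    by_contra hne
    exact hw ⟨K ∪ M, ⟨hKc.union hMc, hK.union ⟨y, hyK, hyM⟩ hM, hne, Or.inr hq⟩, Or.inl hwK⟩
  rcases (hKM.symm ▸ mem_univ a : a ∈ K ∪ M) with h | h
  · exact hKA h haA
  · exact haq ⟨M, ⟨hMc, hM, hMu, hq⟩, h⟩

theorem stmt8 (X : Type*) [MetricSpace X] [CompactSpace X] [ConnectedSpace X] [Nonempty X]
    (p q : X) (hdec : DecomposableSet (univ : Set X)) (hirr : IrrBetween p q)
    (A : Set X) (hAne : A.Nonempty) (hAcl : IsClosed A)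
    (hAint : (A ∩ (composant q)ᶜ).Nonempty)
    (w : X) (hw : w ∈ (composant q)ᶜ \ A) :
    ¬ NotBlocks A w := by
  obtain ⟨M, N, hMc, hM, -, hMu, hNc, hN, -, hNu, hMN⟩ := hdec
  rcases (hMN.symm ▸ mem_univ q : q ∈ M ∪ N) with hq | hq
  · exact not_notBlocks_of_cover hMc hM hMu hq hNc hNu hMN hAint hw.1
  · exact not_notBlocks_of_cover hNc hN hNu hq hMc hMu (union_comm N M ▸ hMN) hAint hw.1
end
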